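/- Let N ≥ 2 and d ≥ 1. For each i ∈ {1,…,d}, let (μ_{t,i})_{t∈{1,…,N}} be probability measures on ℝ with finite first moments such that each consecutive pair μ_{t,i} ⪯_c μ_{t+1,i} is in convex order and irreducible. Let c : ℝ^{Nd} → ℝ be upper semi-continuous and satisfy |c(x)| ≤ Σ_{t=1}^N Σ_{i=1}^d v_{t,i}(x_{t,i}) for some continuous functions v_{t,i} ∈ L¹(μ_{t,i}). Then there exist measurable functions φ_{t,i} : ℝ → ℝ ∪ {+∞} which are real-valued μ_{t,i}-almost surely, and real-valued measurable functions h_{t,i} : ℝ^{td} → ℝ for t ∈ {1,…,N−1} (with h_{N,i} ≡ 0), such that Σ_{t=1}^N Σ_{i=1}^d [φ_{t,i}(x_{t,i}) + h_{t,i}(x_1,…,x_t)(x_{t+1,i} − x_{t,i})] ≥ c(x) for every x ∈ (ℝ^d)^N, with equality holding π-almost surely for every π ∈ VMT(μ) that maximizes ∫ c dπ over VMT(μ). -/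

import Mathlib

open MeasureTheory Filter

noncomputable section

/-- Convex order for probability measures on ℝ. -/
def ConvexOrder1 (μ ν : Measure ℝ) : Prop :=
  ∀ f : ℝ → ℝ, ConvexOn ℝ Set.univ f → Integrable f μ → Integrable f ν →
    ∫ x, f x ∂μ ≤ ∫ x, f x ∂ν

/-- Potential function u_μ(x) = ∫ |x - y| dμ(y). -/
def potentialFn (μ : Measure ℝ) (x : ℝ) : ℝ := ∫ y, |x - y| ∂μ

/-- Irreducibility of a pair μ ⪯_c ν: the set I = {u_μ < u_ν} is a connected
(open) interval of full μ-measure. -/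
def IrreduciblePair (μ ν : Measure ℝ) : Prop :=
  IsPreconnected {x | potentialFn μ x < potentialFn ν x} ∧
  μ {x | potentialFn μ x < potentialFn ν x} = 1

/-- Vectorial martingale transports: probability measures on (ℝ^d)^N whose coordinate
process is an ℝ^d-valued martingale in its natural filtration with the given
one-dimensional marginals. -/
def VMT (N d : ℕ) (μ : Fin N → Fin d → Measure ℝ) :
    Set (Measure (Fin N → Fin d → ℝ)) :=
  {π | IsProbabilityMeasure π ∧
    (∀ t i, π.map (fun x => x t i) = μ t i) ∧
    ∀ (t : ℕ) (ht : t + 1 < N),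
      π[(fun x => x ⟨t + 1, ht⟩) |
        MeasurableSpace.comap
          (fun (x : Fin N → Fin d → ℝ) (s : Fin (t + 1)) =>
            x ⟨s.val, by have := s.isLt; omega⟩) inferInstance]
        =ᵐ[π] fun x => x ⟨t, by omega⟩}

/-- Payout of the semi-static hedging portfolio (φ, h) along the path x, valued in
ℝ ∪ {−∞} (resp. ℝ ∪ {+∞}) via EReal; the t = N trading term vanishes by convention. -/
def portfolioPayout (N d : ℕ) (φ : Fin N → Fin d → ℝ → EReal)
    (h : (t : ℕ) → Fin d → (Fin t → Fin d → ℝ) → ℝ)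
    (x : Fin N → Fin d → ℝ) : EReal :=
  ∑ t : Fin N, ∑ i : Fin d,
    (φ t i (x t i) +
      ((if ht : (t : ℕ) + 1 < N then
          h ((t : ℕ) + 1) i (fun s => x ⟨s.val, by have := s.isLt; have := t.isLt; omega⟩) *
            (x ⟨(t : ℕ) + 1, ht⟩ i - x t i)
        else 0 : ℝ) : EReal))

/-- Real-valued payout. -/
def payR (N d : ℕ) (φ : Fin N → Fin d → ℝ → ℝ)
    (h : (t : ℕ) → Fin d → (Fin t → Fin d → ℝ) → ℝ)
    (x : Fin N → Fin d → ℝ) : ℝ :=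
  ∑ t : Fin N, ∑ i : Fin d,
    (φ t i (x t i) +
      (if ht : (t : ℕ) + 1 < N then
          h ((t : ℕ) + 1) i (fun s => x ⟨s.val, by have := s.isLt; have := t.isLt; omega⟩) *
            (x ⟨(t : ℕ) + 1, ht⟩ i - x t i)
        else 0))



lemma meas_ev {N d : ℕ} (t : Fin N) (i : Fin d) :
    Measurable (fun x : Fin N → Fin d → ℝ => x t i) :=
  (measurable_pi_apply i).comp (measurable_pi_apply t)

lemma cont_ev {N d : ℕ} (t : Fin N) (i : Fin d) :
    Continuous (fun x : Fin N → Fin d → ℝ => x t i) :=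
  (continuous_apply i).comp (continuous_apply t)

lemma meas_restr {N d m : ℕ} (f : Fin m → Fin N) :
    Measurable (fun (x : Fin N → Fin d → ℝ) (s : Fin m) => x (f s)) :=
  measurable_pi_lambda _ fun s => measurable_pi_apply (f s)

lemma cont_restr {N d m : ℕ} (f : Fin m → Fin N) :
    Continuous (fun (x : Fin N → Fin d → ℝ) (s : Fin m) => x (f s)) :=
  continuous_pi fun s => continuous_apply (f s)

section Mart
variable {N d : ℕ} {μ : Fin N → Fin d → Measure ℝ} {π : Measure (Fin N → Fin d → ℝ)}

lemma vmt_integrable (hπ : π ∈ VMT N d μ) (t : Fin N) (i : Fin d) (f : ℝ → ℝ)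
    (hf : Measurable f) (hi : Integrable f (μ t i)) :
    Integrable (fun x => f (x t i)) π := by
  have h := hπ.2.1 t i
  rw [← h] at hi
  exact (integrable_map_measure hf.aestronglyMeasurable (meas_ev t i).aemeasurable).1 hi

lemma vmt_integral (hπ : π ∈ VMT N d μ) (t : Fin N) (i : Fin d) (f : ℝ → ℝ)
    (hf : Measurable f) :
    ∫ x, f (x t i) ∂π = ∫ y, f y ∂(μ t i) := by
  rw [← hπ.2.1 t i]
  exact (integral_map (meas_ev t i).aemeasurable hf.aestronglyMeasurable).symm

lemma vmt_mart (hmom : ∀ t i, Integrable id (μ t i)) (hπ : π ∈ VMT N d μ)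
    (t : ℕ) (ht : t + 1 < N) (i : Fin d) (k : (Fin (t + 1) → Fin d → ℝ) → ℝ)
    (hk : Measurable k) (M : ℝ) (hM : ∀ y, |k y| ≤ M) :
    Integrable (fun x : Fin N → Fin d → ℝ =>
      k (fun s => x ⟨s.val, by have := s.isLt; omega⟩) *
        (x ⟨t + 1, ht⟩ i - x ⟨t, by omega⟩ i)) π ∧
    ∫ x : Fin N → Fin d → ℝ, k (fun s => x ⟨s.val, by have := s.isLt; omega⟩) *
        (x ⟨t + 1, ht⟩ i - x ⟨t, by omega⟩ i) ∂π = 0 := by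
  have := hπ.1
  have hc := hπ.2.2 t ht
  set m : MeasurableSpace (Fin N → Fin d → ℝ) := MeasurableSpace.comap
          (fun (x : Fin N → Fin d → ℝ) (s : Fin (t + 1)) =>
            x ⟨s.val, by have := s.isLt; omega⟩) inferInstance with hm
  have hmle : m ≤ MeasurableSpace.pi :=
    Measurable.comap_le (meas_restr _)
  have hintg : ∀ s : Fin N, Integrable (fun x : Fin N → Fin d → ℝ => x s) π := fun s =>
    Integrable.of_eval (fun j => vmt_integrable hπ s j id measurable_id (hmom s j))
  have hmt : Measurable[m] (fun x : Fin N → Fin d → ℝ => fun s : Fin (t + 1) =>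
      x ⟨s.val, by have := s.isLt; omega⟩) := comap_measurable _
  set D : (Fin N → Fin d → ℝ) → ℝ := fun x => x ⟨t + 1, ht⟩ i - x ⟨t, by omega⟩ i with hD
  have hDi : Integrable D π := ((hintg ⟨t+1, ht⟩).eval i).sub ((hintg ⟨t, by omega⟩).eval i)
  have hxi : StronglyMeasurable[m] (fun x : Fin N → Fin d → ℝ => x ⟨t, by omega⟩ i) := by
    have h2 : Measurable (fun y : Fin (t+1) → Fin d → ℝ => y ⟨t, by omega⟩ i) := meas_ev _ _
    exact (h2.comp hmt).stronglyMeasurable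
  have hcD : π[D | m] =ᵐ[π] 0 := by
    have h1 := condExp_sub ((hintg ⟨t+1, ht⟩).eval i) ((hintg ⟨t, by omega⟩).eval i) m
    have h2 := ContinuousLinearMap.comp_condExp_comm (m := m) (hintg ⟨t+1, ht⟩)
      (ContinuousLinearMap.proj (R := ℝ) (φ := fun _ : Fin d => ℝ) i)
    have h3 := condExp_of_stronglyMeasurable hmle hxi ((hintg ⟨t, by omega⟩).eval i)
    filter_upwards [h1, h2, hc] with x h1 h2 hc
    have e : (fun x : Fin N → Fin d → ℝ => x ⟨t+1,ht⟩ i) - (fun x => x ⟨t, by omega⟩ i) = D := rfl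
    rw [e] at h1
    rw [h1, Pi.sub_apply, h3]
    have h4 : (π[(fun x : Fin N → Fin d → ℝ => x ⟨t+1,ht⟩ i) | m]) x = x ⟨t, by omega⟩ i := by
      refine Eq.trans ?_ (congrFun hc i)
      exact h2.symm
    rw [h4]; simp
  have hkm : StronglyMeasurable[m] (fun x : Fin N → Fin d → ℝ =>
      k (fun s : Fin (t+1) => x ⟨s.val, by have := s.isLt; omega⟩)) :=
    (hk.comp hmt).stronglyMeasurable
  have hI : Integrable (fun x : Fin N → Fin d → ℝ =>
      k (fun s : Fin (t+1) => x ⟨s.val, by have := s.isLt; omega⟩) * D x) π := by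
    refine hDi.bdd_mul (c := M) ?_ ?_
    · exact (hkm.mono hmle).aestronglyMeasurable
    · exact Eventually.of_forall fun x => hM _
  refine ⟨hI, ?_⟩
  have h5 := condExp_mul_of_stronglyMeasurable_left hkm hI hDi
  have h6 := integral_condExp hmle (μ := π) (f := (fun x : Fin N → Fin d → ℝ =>
      k (fun s : Fin (t+1) => x ⟨s.val, by have := s.isLt; omega⟩)) * D)
  have h7 : ∫ x, ((fun x : Fin N → Fin d → ℝ =>
      k (fun s : Fin (t+1) => x ⟨s.val, by have := s.isLt; omega⟩)) * D) x ∂π = 0 := by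
    rw [← h6]
    rw [integral_congr_ae (g := fun _ => 0)]
    · simp
    · filter_upwards [h5, hcD] with x h5 hcD
      rw [h5]; simp [hcD]
  exact h7

lemma vmt_pay (hmom : ∀ t i, Integrable id (μ t i)) (hπ : π ∈ VMT N d μ)
    (φ : Fin N → Fin d → ℝ → ℝ)
    (h : (t : ℕ) → Fin d → (Fin t → Fin d → ℝ) → ℝ)
    (hφ : ∀ t i, Measurable (φ t i)) (hφi : ∀ t i, Integrable (φ t i) (μ t i))
    (hh : ∀ t i, Measurable (h t i)) (M : ℝ) (hM : ∀ t i y, |h t i y| ≤ M) :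
    Integrable (payR N d φ h) π ∧
    ∫ x, payR N d φ h x ∂π = ∑ t, ∑ i, ∫ y, φ t i y ∂(μ t i) := by
  have key : ∀ (t : Fin N) (i : Fin d), Integrable (fun x : Fin N → Fin d → ℝ => φ t i (x t i) +
      (if ht : (t : ℕ) + 1 < N then
          h ((t : ℕ) + 1) i (fun s => x ⟨s.val, by have := s.isLt; have := t.isLt; omega⟩) *
            (x ⟨(t : ℕ) + 1, ht⟩ i - x t i)
        else 0)) π ∧ ∫ x : Fin N → Fin d → ℝ, (φ t i (x t i) +
      (if ht : (t : ℕ) + 1 < N then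
          h ((t : ℕ) + 1) i (fun s => x ⟨s.val, by have := s.isLt; have := t.isLt; omega⟩) *
            (x ⟨(t : ℕ) + 1, ht⟩ i - x t i)
        else 0)) ∂π = ∫ y, φ t i y ∂(μ t i) := by
    intro t i
    have h1 := vmt_integrable hπ t i (φ t i) (hφ t i) (hφi t i)
    have h2 := vmt_integral hπ t i (φ t i) (hφ t i)
    by_cases ht : (t : ℕ) + 1 < N
    · have h3 := vmt_mart hmom hπ t ht i (h (t+1) i) (hh _ _) M (hM _ _)
      simp only [ht, dif_pos]
      refine ⟨h1.add h3.1, ?_⟩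
      rw [integral_add h1 h3.1, h2]
      have := h3.2
      simp only [Fin.eta] at this
      rw [this, add_zero]
    · simp only [ht, dif_neg, not_false_eq_true, add_zero]
      exact ⟨h1, h2⟩
  constructor
  · exact integrable_finsetSum _ fun t _ => integrable_finsetSum _ fun i _ => (key t i).1
  · unfold payR
    rw [integral_finsetSum _ fun t _ => integrable_finsetSum _ fun i _ => (key t i).1]
    refine Finset.sum_congr rfl fun t _ => ?_
    rw [integral_finsetSum _ fun i _ => (key t i).1]
    exact Finset.sum_congr rfl fun i _ => (key t i).2

end Mart


section Alg
variable {N d : ℕ}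

lemma payR_add (φ φ' : Fin N → Fin d → ℝ → ℝ) (h h' : (t : ℕ) → Fin d → (Fin t → Fin d → ℝ) → ℝ)
    (x : Fin N → Fin d → ℝ) :
    payR N d (φ + φ') (h + h') x = payR N d φ h x + payR N d φ' h' x := by
  unfold payR
  simp only [← Finset.sum_add_distrib]
  refine Finset.sum_congr rfl fun t _ => Finset.sum_congr rfl fun i _ => ?_
  by_cases ht : (t : ℕ) + 1 < N
  · simp only [ht, dif_pos, Pi.add_apply]; ring
  · simp only [ht, dif_neg, not_false_eq_true, Pi.add_apply]; ring

lemma payR_smul (r : ℝ) (φ : Fin N → Fin d → ℝ → ℝ)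
    (h : (t : ℕ) → Fin d → (Fin t → Fin d → ℝ) → ℝ) (x : Fin N → Fin d → ℝ) :
    payR N d (r • φ) (r • h) x = r * payR N d φ h x := by
  unfold payR
  simp only [Finset.mul_sum]
  refine Finset.sum_congr rfl fun t _ => Finset.sum_congr rfl fun i _ => ?_
  by_cases ht : (t : ℕ) + 1 < N
  · simp only [ht, dif_pos, Pi.smul_apply, smul_eq_mul]; ring
  · simp only [ht, dif_neg, not_false_eq_true, Pi.smul_apply, smul_eq_mul]; ring

lemma payR_zero_h (φ : Fin N → Fin d → ℝ → ℝ) (x : Fin N → Fin d → ℝ) :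
    payR N d φ 0 x = ∑ t, ∑ i, φ t i (x t i) := by
  unfold payR; simp

end Alg

section Riesz
variable {N d : ℕ} {μ : Fin N → Fin d → Measure ℝ}

/-- functions dominated by a separable integrable continuous function -/
def Wsp (N d : ℕ) (μ : Fin N → Fin d → Measure ℝ) : Submodule ℝ ((Fin N → Fin d → ℝ) → ℝ) where
  carrier := {f | ∃ φ : Fin N → Fin d → ℝ → ℝ, (∀ t i, Continuous (φ t i)) ∧
    (∀ t i, Integrable (φ t i) (μ t i)) ∧ ∀ x, |f x| ≤ ∑ t, ∑ i, φ t i (x t i)}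
  add_mem' := by
    rintro f g ⟨φ, h1, h2, h3⟩ ⟨ψ, k1, k2, k3⟩
    refine ⟨φ + ψ, fun t i => (h1 t i).add (k1 t i), fun t i => (h2 t i).add (k2 t i), fun x => ?_⟩
    simp only [Pi.add_apply, Finset.sum_add_distrib]
    exact (abs_add_le _ _).trans (add_le_add (h3 x) (k3 x))
  zero_mem' := ⟨0, fun t i => continuous_const, fun t i => integrable_zero _ _ _, by simp⟩
  smul_mem' := by
    rintro r f ⟨φ, h1, h2, h3⟩
    refine ⟨|r| • φ, fun t i => (h1 t i).const_smul |r|, fun t i => (h2 t i).smul |r|, fun x => ?_⟩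
    simp only [Pi.smul_apply, smul_eq_mul, abs_mul, ← Finset.mul_sum]
    exact mul_le_mul_of_nonneg_left (h3 x) (abs_nonneg _)

lemma Wsp_mono {f g : (Fin N → Fin d → ℝ) → ℝ} (hg : g ∈ Wsp N d μ) (h : ∀ x, |f x| ≤ g x) :
    f ∈ Wsp N d μ := by
  obtain ⟨φ, h1, h2, h3⟩ := hg
  exact ⟨φ, h1, h2, fun x => (h x).trans ((le_abs_self _).trans (h3 x))⟩

lemma Wsp_abs {f : (Fin N → Fin d → ℝ) → ℝ} (hf : f ∈ Wsp N d μ) :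
    (fun x => |f x|) ∈ Wsp N d μ := by
  obtain ⟨φ, h1, h2, h3⟩ := hf
  exact ⟨φ, h1, h2, fun x => by rw [abs_abs]; exact h3 x⟩

lemma sum_single_ev (t : Fin N) (i : Fin d) (f : ℝ → ℝ) (x : Fin N → Fin d → ℝ) :
    ∑ s, ∑ j, (if s = t ∧ j = i then f else 0) (x s j) = f (x t i) := by
  rw [Finset.sum_eq_single t, Finset.sum_eq_single i]
  · simp
  · intro j _ hj; simp [hj]
  · simp
  · intro s _ hs; simp [hs]
  · simp

lemma Wsp_ev (t : Fin N) (i : Fin d) (φ : ℝ → ℝ) (h1 : Continuous φ) (h2 : Integrable φ (μ t i)) :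
    (fun x => φ (x t i)) ∈ Wsp N d μ := by
  refine ⟨fun s j => if s = t ∧ j = i then (fun y => |φ y|) else 0, ?_, ?_, ?_⟩
  · intro s j
    dsimp only
    split_ifs
    · exact h1.abs
    · exact continuous_const
  · intro s j
    dsimp only
    split_ifs with h
    · obtain ⟨rfl, rfl⟩ := h; exact h2.abs
    · exact integrable_zero _ _ _
  · intro x
    rw [sum_single_ev t i (fun y => |φ y|) x]

lemma Wsp_const (hN : 0 < N) (hd : 0 < d) (hprob : ∀ t i, IsProbabilityMeasure (μ t i)) (r : ℝ) :
    (fun _ => r) ∈ Wsp N d μ := by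
  have := Wsp_ev (μ := μ) ⟨0, hN⟩ ⟨0, hd⟩ (fun _ => r) continuous_const (integrable_const _)
  exact this

lemma Wsp_norm (hmom : ∀ t i, Integrable id (μ t i)) :
    (fun x => ‖x‖) ∈ Wsp N d μ := by
  refine ⟨fun t i y => |y|, fun t i => continuous_abs, fun t i => (hmom t i).abs, fun x => ?_⟩
  rw [abs_norm]
  refine (pi_norm_le_iff_of_nonneg (by positivity)).2 fun t => ?_
  refine (pi_norm_le_iff_of_nonneg (by positivity)).2 fun i => ?_
  rw [Real.norm_eq_abs]
  refine (Finset.single_le_sum (f := fun i => |x t i|) (fun _ _ => abs_nonneg _) (Finset.mem_univ i)).trans ?_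
  exact Finset.single_le_sum (f := fun t => ∑ i, |x t i|) (fun _ _ => by positivity) (Finset.mem_univ t)

lemma tail_tendsto (ν : Measure ℝ) [IsProbabilityMeasure ν] (φ : ℝ → ℝ) (hc : Continuous φ)
    (hi : Integrable φ ν) :
    Tendsto (fun M : ℕ => ∫ y, max (φ y - M) 0 ∂ν) atTop (nhds 0) := by
  have h0 : (0:ℝ) = ∫ y, (0:ℝ) ∂ν := by simp
  suffices Tendsto (fun M : ℕ => ∫ y, max (φ y - M) 0 ∂ν) atTop (nhds (∫ y, (0:ℝ) ∂ν)) by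
    rwa [← h0] at this
  refine tendsto_integral_of_dominated_convergence (fun y => |φ y|) ?_ hi.abs ?_ ?_
  · intro n; exact Continuous.aestronglyMeasurable (by fun_prop)
  · intro n; refine Eventually.of_forall fun y => ?_
    have : (0:ℝ) ≤ n := Nat.cast_nonneg n
    rw [Real.norm_eq_abs, abs_of_nonneg (le_max_right _ _)]
    refine max_le ?_ (abs_nonneg _)
    linarith [le_abs_self (φ y)]
  · refine Eventually.of_forall fun y => ?_
    refine tendsto_const_nhds.congr' ?_
    obtain ⟨n, hn⟩ := exists_nat_ge (φ y)
    filter_upwards [eventually_ge_atTop n] with m hm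
    have : (n:ℝ) ≤ m := by exact_mod_cast hm
    rw [max_eq_right]; linarith

/-- cutoff -/
def kap (N d : ℕ) (n : ℕ) (x : Fin N → Fin d → ℝ) : ℝ := max 0 (1 - ‖x‖ / (n + 1))

lemma kap_cont (n : ℕ) : Continuous (kap N d n) := by unfold kap; fun_prop
lemma kap_nonneg (n : ℕ) (x) : 0 ≤ kap N d n x := le_max_left _ _
lemma kap_le_one (n : ℕ) (x) : kap N d n x ≤ 1 := by
  unfold kap
  have : 0 ≤ ‖x‖ / (n + 1 : ℝ) := by positivity
  exact max_le (by norm_num) (by linarith)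
lemma kap_compl (n : ℕ) (x) : 1 - kap N d n x ≤ ‖x‖ / (n + 1) := by
  unfold kap
  have := le_max_right 0 (1 - ‖x‖ / (n + 1 : ℝ))
  linarith
lemma kap_tendsto (x) : Tendsto (fun n => kap N d n x) atTop (nhds 1) := by
  unfold kap
  have h1 : Tendsto (fun n : ℕ => ‖x‖ * (1 / ((n : ℝ) + 1))) atTop (nhds (‖x‖ * 0)) :=
    tendsto_one_div_add_atTop_nhds_zero_nat.const_mul _
  have h2 : Tendsto (fun n : ℕ => max 0 (1 - ‖x‖ * (1 / ((n : ℝ) + 1)))) atTop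
    (nhds (max 0 (1 - ‖x‖ * 0))) := tendsto_const_nhds.max (tendsto_const_nhds.sub h1)
  simpa [div_eq_mul_inv] using h2
lemma kap_supp (n : ℕ) : HasCompactSupport (kap N d n) := by
  refine HasCompactSupport.of_support_subset_isCompact (isCompact_closedBall (0 : Fin N → Fin d → ℝ) (n+1)) ?_
  intro x hx
  rw [mem_closedBall_zero_iff]
  by_contra hcon
  apply hx
  unfold kap
  push Not at hcon
  rw [max_eq_left]
  have : 1 ≤ ‖x‖ / (n + 1 : ℝ) := by rw [le_div_iff₀ (by positivity)]; linarith
  linarith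

lemma riesz_rep (hN : 0 < N) (hd : 0 < d) (hprob : ∀ t i, IsProbabilityMeasure (μ t i))
    (hmom : ∀ t i, Integrable id (μ t i))
    (l : ((Fin N → Fin d → ℝ) → ℝ) →ₗ[ℝ] ℝ)
    (hpos : ∀ f ∈ Wsp N d μ, (∀ x, 0 ≤ f x) → 0 ≤ l f)
    (hmarg : ∀ t i (φ : ℝ → ℝ), Continuous φ → Integrable φ (μ t i) →
      l (fun x => φ (x t i)) = ∫ y, φ y ∂(μ t i)) :
    ∃ π' : Measure (Fin N → Fin d → ℝ), ∀ f ∈ Wsp N d μ, Continuous f →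
      Integrable f π' ∧ ∫ x, f x ∂π' = l f := by
  have hccW : ∀ f : CompactlySupportedContinuousMap (Fin N → Fin d → ℝ) ℝ, (f : _ → ℝ) ∈ Wsp N d μ := by
    intro f
    obtain ⟨C, hC⟩ := f.hasCompactSupport.exists_bound_of_continuous f.continuous
    exact Wsp_mono (Wsp_const hN hd hprob C) hC
  let L0 : CompactlySupportedContinuousMap (Fin N → Fin d → ℝ) ℝ →ₗ[ℝ] ℝ :=
    { toFun := fun f => l (f : _ → ℝ)
      map_add' := fun f g => by rw [← map_add]; rfl
      map_smul' := fun r f => by rw [← map_smul]; rfl }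
  let Λ := PositiveLinearMap.mk₀ L0 (fun f hf => hpos _ (hccW f) hf)
  refine ⟨RealRMK.rieszMeasure Λ, ?_⟩
  set π' := RealRMK.rieszMeasure Λ
  have hmono : ∀ f ∈ Wsp N d μ, ∀ g ∈ Wsp N d μ, (∀ x, f x ≤ g x) → l f ≤ l g := by
    intro f hf g hg hfg
    have := hpos (g - f) ((Wsp N d μ).sub_mem hg hf) (fun x => sub_nonneg.2 (hfg x))
    rw [map_sub] at this; linarith
  -- the cut off functions
  have hcut : ∀ f : (Fin N → Fin d → ℝ) → ℝ, Continuous f → ∀ n,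
      Integrable (fun x => f x * kap N d n x) π' ∧ ∫ x, f x * kap N d n x ∂π' = l (fun x => f x * kap N d n x) := by
    intro f hf n
    let F : CompactlySupportedContinuousMap (Fin N → Fin d → ℝ) ℝ :=
      ⟨⟨fun x => f x * kap N d n x, hf.mul (kap_cont n)⟩, (kap_supp n).mul_left⟩
    exact ⟨F.continuous.integrable_of_hasCompactSupport F.hasCompactSupport, RealRMK.integral_rieszMeasure Λ F⟩
  have hcutW : ∀ f ∈ Wsp N d μ, ∀ n, (fun x => f x * kap N d n x) ∈ Wsp N d μ := by
    intro f hf n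
    refine Wsp_mono (Wsp_abs hf) fun x => ?_
    rw [abs_mul, abs_of_nonneg (kap_nonneg n x)]
    exact mul_le_of_le_one_right (abs_nonneg _) (kap_le_one n x)
  have hintg : ∀ f ∈ Wsp N d μ, Continuous f → Integrable f π' := by
    intro f hf hfc
    refine ⟨hfc.aestronglyMeasurable, ?_⟩
    rw [hasFiniteIntegral_iff_norm]
    have h1 : ∀ n, ∫⁻ x, ENNReal.ofReal (|f x| * kap N d n x) ∂π' ≤ ENNReal.ofReal (l fun x => |f x|) := by
      intro n
      obtain ⟨h1, h2⟩ := hcut (fun x => |f x|) hfc.abs n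
      rw [← ofReal_integral_eq_lintegral_ofReal h1
        (Eventually.of_forall fun x => mul_nonneg (abs_nonneg _) (kap_nonneg n x)), h2]
      refine ENNReal.ofReal_le_ofReal (hmono _ (hcutW _ (Wsp_abs hf) n) _ (Wsp_abs hf) fun x => ?_)
      exact mul_le_of_le_one_right (abs_nonneg _) (kap_le_one n x)
    calc ∫⁻ x, ENNReal.ofReal ‖f x‖ ∂π'
        = ∫⁻ x, liminf (fun n => ENNReal.ofReal (|f x| * kap N d n x)) atTop ∂π' := by
          refine lintegral_congr fun x => ?_
          refine (Tendsto.liminf_eq ?_).symm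
          refine (ENNReal.continuous_ofReal.tendsto _).comp ?_
          have := (kap_tendsto x).const_mul |f x|
          rwa [mul_one] at this
      _ ≤ liminf (fun n => ∫⁻ x, ENNReal.ofReal (|f x| * kap N d n x) ∂π') atTop :=
          lintegral_liminf_le fun n => by
            have : Continuous fun x => |f x| * kap N d n x := hfc.abs.mul (kap_cont n)
            exact this.measurable.ennreal_ofReal
      _ ≤ liminf (fun n : ℕ => ENNReal.ofReal (l fun x => |f x|)) atTop :=
          liminf_le_liminf (Eventually.of_forall h1)
      _ < ⊤ := by simp
  intro f hf hfc
  have hfi := hintg f hf hfc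
  refine ⟨hfi, ?_⟩
  have hlim1 : Tendsto (fun n => ∫ x, f x * kap N d n x ∂π') atTop (nhds (∫ x, f x ∂π')) := by
    refine tendsto_integral_of_dominated_convergence (fun x => |f x|) ?_ hfi.abs ?_ ?_
    · intro n; exact (hfc.mul (kap_cont n)).aestronglyMeasurable
    · intro n; refine Eventually.of_forall fun x => ?_
      rw [Real.norm_eq_abs, abs_mul, abs_of_nonneg (kap_nonneg n x)]
      exact mul_le_of_le_one_right (abs_nonneg _) (kap_le_one n x)
    · refine Eventually.of_forall fun x => ?_
      have := (kap_tendsto x).const_mul (f x)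
      rwa [mul_one] at this
  have hlim2 : Tendsto (fun n => l (fun x => f x * kap N d n x)) atTop (nhds (l f)) := by
    obtain ⟨φ, h1, h2, h3⟩ := id hf
    set C := l (fun x => ‖x‖)
    have hbound : ∀ M n : ℕ, |l f - l (fun x => f x * kap N d n x)| ≤
        ∑ t, ∑ i, (∫ y, max (φ t i y - M) 0 ∂(μ t i) + (M * (1 / ((n:ℝ) + 1))) * C) := by
      intro M n
      have hgW : ∀ t i, (fun x : Fin N → Fin d → ℝ => max (φ t i (x t i) - M) 0) ∈ Wsp N d μ := fun t i =>
        Wsp_ev t i (fun y => max (φ t i y - M) 0) (by have := h1 t i; fun_prop)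
          (((h2 t i).sub (integrable_const _)).pos_part)
      let G : (Fin N → Fin d → ℝ) → ℝ := ∑ t, ∑ i, ((fun x : Fin N → Fin d → ℝ => max (φ t i (x t i) - M) 0) +
        (M * (1 / ((n:ℝ) + 1))) • (fun x => ‖x‖))
      have hG : l G = ∑ t, ∑ i, (∫ y, max (φ t i y - M) 0 ∂(μ t i) + (M * (1 / ((n:ℝ) + 1))) * C) := by
        simp only [G, map_sum, map_add, map_smul, smul_eq_mul]
        refine Finset.sum_congr rfl fun t _ => Finset.sum_congr rfl fun i _ => ?_
        congr 1
        exact hmarg t i (fun y => max (φ t i y - M) 0) (by have := h1 t i; fun_prop)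
          (((h2 t i).sub (integrable_const _)).pos_part)
      have hGW : G ∈ Wsp N d μ := Submodule.sum_mem _ fun t _ => Submodule.sum_mem _ fun i _ =>
        Submodule.add_mem _ (hgW t i) (Submodule.smul_mem _ _ (Wsp_norm hmom))
      have hGx : ∀ x, |f x * (1 - kap N d n x)| ≤ G x := by
        intro x
        have k0 := kap_nonneg (N := N) (d := d) n x
        have k1 := kap_le_one (N := N) (d := d) n x
        have k2 := kap_compl (N := N) (d := d) n x
        have hM : (0:ℝ) ≤ M := Nat.cast_nonneg M
        rw [abs_mul, abs_of_nonneg (by linarith : 0 ≤ 1 - kap N d n x)]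
        refine (mul_le_mul_of_nonneg_right (h3 x) (by linarith)).trans ?_
        simp only [G, Finset.sum_apply, Finset.sum_mul, Pi.add_apply, Pi.smul_apply, smul_eq_mul]
        refine Finset.sum_le_sum fun t _ => Finset.sum_le_sum fun i _ => ?_
        have a1 := le_max_left (φ t i (x t i) - M) 0
        have a2 := le_max_right (φ t i (x t i) - M) 0
        set m := max (φ t i (x t i) - M) 0
        calc φ t i (x t i) * (1 - kap N d n x) ≤ (m + M) * (1 - kap N d n x) :=
              mul_le_mul_of_nonneg_right (by linarith) (by linarith)
          _ = m * (1 - kap N d n x) + M * (1 - kap N d n x) := by ring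
          _ ≤ m * 1 + M * (‖x‖ / (n + 1)) := by
              gcongr; linarith
          _ = _ := by ring
      have e : l f - l (fun x => f x * kap N d n x) = l (fun x => f x * (1 - kap N d n x)) := by
        rw [← map_sub]; congr 1; ext x; simp only [Pi.sub_apply]; ring
      have hfW : (fun x => f x * (1 - kap N d n x)) ∈ Wsp N d μ := Wsp_mono hGW hGx
      rw [e, ← hG, abs_le]
      constructor
      · rw [← map_neg]
        exact hmono _ (Submodule.neg_mem _ hGW) _ hfW fun x => (abs_le.1 (hGx x)).1
      · exact hmono _ hfW _ hGW fun x => (abs_le.1 (hGx x)).2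
    rw [Metric.tendsto_atTop]
    intro ε hε
    have t1 : Tendsto (fun M : ℕ => ∑ t, ∑ i, ∫ y, max (φ t i y - M) 0 ∂(μ t i)) atTop
        (nhds (∑ t : Fin N, ∑ i : Fin d, (0:ℝ))) :=
      tendsto_finsetSum _ fun t _ => tendsto_finsetSum _ fun i _ => tail_tendsto _ _ (h1 t i) (h2 t i)
    simp only [Finset.sum_const_zero] at t1
    obtain ⟨M, hM⟩ := (t1.eventually (gt_mem_nhds (half_pos hε))).exists
    have t2 : Tendsto (fun n : ℕ => ∑ t : Fin N, ∑ i : Fin d, (M * (1 / ((n:ℝ) + 1))) * C) atTop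
        (nhds (∑ t : Fin N, ∑ i : Fin d, (M * 0) * C)) :=
      tendsto_finsetSum _ fun t _ => tendsto_finsetSum _ fun i _ =>
        (tendsto_one_div_add_atTop_nhds_zero_nat.const_mul _).mul_const _
    simp only [mul_zero, zero_mul, Finset.sum_const_zero] at t2
    obtain ⟨n0, hn0⟩ := eventually_atTop.1 (t2.eventually (gt_mem_nhds (half_pos hε)))
    refine ⟨n0, fun n hn => ?_⟩
    rw [dist_comm, Real.dist_eq]
    refine (hbound M n).trans_lt ?_
    simp only [Finset.sum_add_distrib] at hM ⊢
    have := hn0 n hn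
    linarith
  have hlim1' : Tendsto (fun n => l (fun x => f x * kap N d n x)) atTop (nhds (∫ x, f x ∂π')) :=
    hlim1.congr fun n => (hcut f hfc n).2
  exact tendsto_nhds_unique hlim1' hlim2

end Riesz


section Dual
variable {N d : ℕ} {μ : Fin N → Fin d → Measure ℝ}

lemma mem_VMT_of (π : Measure (Fin N → Fin d → ℝ)) [IsProbabilityMeasure π]
    (hmom : ∀ t i, Integrable id (μ t i))
    (hmarg : ∀ t i, π.map (fun x => x t i) = μ t i)
    (hmart : ∀ (t : ℕ) (ht : t + 1 < N) (i : Fin d)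
      (h : BoundedContinuousFunction (Fin (t + 1) → Fin d → ℝ) ℝ),
      ∫ x : Fin N → Fin d → ℝ, h (fun s => x ⟨s.val, by have := s.isLt; omega⟩) *
        (x ⟨t + 1, ht⟩ i - x ⟨t, by omega⟩ i) ∂π = 0) : π ∈ VMT N d μ := by
  refine ⟨inferInstance, hmarg, fun t ht => ?_⟩
  have hi1 : ∀ t i, Integrable (fun x : Fin N → Fin d → ℝ => x t i) π := by
    intro t i
    have := hmom t i
    rw [← hmarg t i] at this
    exact (integrable_map_measure measurable_id.aestronglyMeasurable (meas_ev t i).aemeasurable).1 this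
  have hintg : ∀ s : Fin N, Integrable (fun x : Fin N → Fin d → ℝ => x s) π := fun s =>
    Integrable.of_eval (fun j => hi1 s j)
  set R : (Fin N → Fin d → ℝ) → (Fin (t + 1) → Fin d → ℝ) :=
    (fun (x : Fin N → Fin d → ℝ) (s : Fin (t + 1)) => x ⟨s.val, by have := s.isLt; omega⟩) with hR
  have hRm : Measurable R := meas_restr _
  have hmle : MeasurableSpace.comap R inferInstance ≤ MeasurableSpace.pi := hRm.comap_le
  have hset : ∀ B : Set (Fin (t+1) → Fin d → ℝ), MeasurableSet B → ∀ i,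
      ∫ x in R ⁻¹' B, (x ⟨t + 1, ht⟩ i - x ⟨t, by omega⟩ i) ∂π = 0 := by
    intro B hB i
    set D : (Fin N → Fin d → ℝ) → ℝ := fun x => x ⟨t + 1, ht⟩ i - x ⟨t, by omega⟩ i with hD
    have hDm : Measurable D := (meas_ev _ _).sub (meas_ev _ _)
    have hDi : Integrable D π := (hi1 _ _).sub (hi1 _ _)
    let P : Measure (Fin N → Fin d → ℝ) := π.withDensity (fun x => ENNReal.ofReal (D x))
    let Q : Measure (Fin N → Fin d → ℝ) := π.withDensity (fun x => ENNReal.ofReal (- D x))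
    have hPf : IsFiniteMeasure P := isFiniteMeasure_withDensity_ofReal hDi.2
    have hQf : IsFiniteMeasure Q := isFiniteMeasure_withDensity_ofReal hDi.neg.2
    have hPe : ∀ g : (Fin N → Fin d → ℝ) → ℝ, ∫ x, g x ∂P = ∫ x, max (D x) 0 * g x ∂π := by
      intro g
      have := integral_withDensity_eq_integral_toReal_smul (μ := π) (f := fun x => ENNReal.ofReal (D x))
        hDm.ennreal_ofReal (Eventually.of_forall fun x => ENNReal.ofReal_lt_top) g
      rw [this]
      simp only [ENNReal.toReal_ofReal', smul_eq_mul]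
    have hQe : ∀ g : (Fin N → Fin d → ℝ) → ℝ, ∫ x, g x ∂Q = ∫ x, max (-D x) 0 * g x ∂π := by
      intro g
      have := integral_withDensity_eq_integral_toReal_smul (μ := π) (f := fun x => ENNReal.ofReal (-D x))
        hDm.neg.ennreal_ofReal (Eventually.of_forall fun x => ENNReal.ofReal_lt_top) g
      rw [this]
      simp only [ENNReal.toReal_ofReal', smul_eq_mul]
    have hbd : ∀ g : (Fin N → Fin d → ℝ) → ℝ, Measurable g → (∃ C, ∀ x, |g x| ≤ C) →
        ∫ x, g x * D x ∂π = ∫ x, g x ∂P - ∫ x, g x ∂Q := by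
      rintro g hg ⟨C, hC⟩
      rw [hPe, hQe, ← integral_sub]
      · refine integral_congr_ae (Eventually.of_forall fun x => ?_)
        simp only
        have : D x = max (D x) 0 - max (-D x) 0 := by
          rcases le_total (D x) 0 with h | h
          · rw [max_eq_right h, max_eq_left (by linarith)]; ring
          · rw [max_eq_left h, max_eq_right (by linarith)]; ring
        nth_rw 1 [this]; ring
      · exact hDi.pos_part.mul_bdd (c := C) hg.aestronglyMeasurable (Eventually.of_forall hC)
      · exact hDi.neg.pos_part.mul_bdd (c := C) hg.aestronglyMeasurable (Eventually.of_forall hC)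
    have hPQ : P.map R = Q.map R := by
      have : IsFiniteMeasure (P.map R) := inferInstance
      have : IsFiniteMeasure (Q.map R) := inferInstance
      refine ext_of_forall_integral_eq_of_IsFiniteMeasure fun h => ?_
      rw [integral_map hRm.aemeasurable h.continuous.aestronglyMeasurable,
        integral_map hRm.aemeasurable h.continuous.aestronglyMeasurable]
      have h1 := hbd (fun x => h (R x)) (h.continuous.measurable.comp hRm)
        ⟨‖h‖, fun x => h.norm_coe_le_norm _⟩
      have h2 := hmart t ht i h
      have h3 : ∫ x, h (R x) * D x ∂π = 0 := h2
      linarith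
    have h1 := hbd ((R ⁻¹' B).indicator 1) (measurable_one.indicator (hRm hB))
      ⟨1, fun x => by by_cases hx : x ∈ R ⁻¹' B <;> simp [hx]⟩
    rw [integral_indicator_one (hRm hB), integral_indicator_one (hRm hB)] at h1
    have h2 : P.real (R ⁻¹' B) = Q.real (R ⁻¹' B) := by
      have := congrArg (fun m => m B) hPQ
      simp only [Measure.map_apply hRm hB] at this
      simp only [Measure.real, this]
    rw [← integral_indicator (hRm hB)]
    rw [h2, sub_self] at h1
    rw [← h1]
    refine integral_congr_ae (Eventually.of_forall fun x => ?_)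
    by_cases hx : x ∈ R ⁻¹' B <;> simp [hx, hD]
  refine (ae_eq_condExp_of_forall_setIntegral_eq hmle (hintg _) ?_ ?_ ?_).symm
  · intro s _ _; exact (hintg _).integrableOn
  · rintro s ⟨B, hB, rfl⟩ _
    ext i
    rw [eval_integral (fun j => ((hintg _).eval j).integrableOn), eval_integral (fun j => ((hintg _).eval j).integrableOn)]
    have := hset B hB i
    rw [integral_sub (hi1 _ _).integrableOn (hi1 _ _).integrableOn] at this
    linarith
  · refine StronglyMeasurable.aestronglyMeasurable ?_
    have h2 : Measurable (fun y : Fin (t+1) → Fin d → ℝ => y ⟨t, by omega⟩) := measurable_pi_apply _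
    exact (h2.comp (comap_measurable R)).stronglyMeasurable

lemma usc_approx {X : Type*} [PseudoMetricSpace X] (c w : X → ℝ) (hc : UpperSemicontinuous c)
    (hw : Continuous w) (hcw : ∀ x, |c x| ≤ w x) :
    ∃ f : ℕ → X → ℝ, (∀ n, Continuous (f n)) ∧ (∀ n x, c x ≤ f n x) ∧ (∀ n x, |f n x| ≤ w x) ∧
      ∀ x, Tendsto (fun n => f n x) atTop (nhds (c x)) := by
  have hg0 : ∀ y, c y - w y ≤ 0 := fun y => by linarith [(abs_le.1 (hcw y)).2]
  have hbdd : ∀ (n : ℕ) x, BddAbove (Set.range fun y => (c y - w y) - n * dist x y) := by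
    intro n x
    refine ⟨0, ?_⟩
    rintro _ ⟨y, rfl⟩
    have : 0 ≤ (n:ℝ) * dist x y := by positivity
    simp only; linarith [hg0 y]
  set F : ℕ → X → ℝ := fun n x => ⨆ y, ((c y - w y) - n * dist x y) with hF
  have hFge : ∀ n x, c x - w x ≤ F n x := by
    intro n x
    have := le_ciSup (hbdd n x) x
    simpa using this
  have hFle : ∀ n x, F n x ≤ 0 := by
    intro n x
    have : Nonempty X := ⟨x⟩
    refine ciSup_le fun y => ?_
    have : 0 ≤ (n:ℝ) * dist x y := by positivity
    linarith [hg0 y]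
  have hFl : ∀ n x x', F n x ≤ F n x' + n * dist x x' := by
    intro n x x'
    have : Nonempty X := ⟨x⟩
    refine ciSup_le fun y => ?_
    have h1 := le_ciSup (hbdd n x') y
    have h2 : dist x' y ≤ dist x x' + dist x y := by
      rw [dist_comm x x']; exact dist_triangle _ _ _
    have h3 : (n:ℝ) * dist x' y ≤ n * (dist x x' + dist x y) := by gcongr
    simp only [hF] at *
    linarith
  have hFc : ∀ n, Continuous (F n) := by
    intro n
    refine LipschitzWith.continuous (K := n) (LipschitzWith.of_le_add_mul _ fun x y => ?_)
    simpa using hFl n x y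
  refine ⟨fun n x => F n x + w x, fun n => (hFc n).add hw, ?_, ?_, ?_⟩
  · intro n x; linarith [hFge n x]
  · intro n x
    rw [abs_le]
    constructor <;> linarith [hFge n x, hFle n x, (abs_le.1 (hcw x)).1]
  · intro x
    have key : Tendsto (fun n => F n x) atTop (nhds (c x - w x)) := by
      refine tendsto_order.2 ⟨fun a ha => Eventually.of_forall fun n => ha.trans_le (hFge n x), fun a ha => ?_⟩
      obtain ⟨b, hb1, hb2⟩ := exists_between ha
      have hus : UpperSemicontinuous (fun y => c y - w y) := by
        have : UpperSemicontinuous (fun y => c y + (- w y)) := hc.add hw.neg.upperSemicontinuous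
        simpa [sub_eq_add_neg] using this
      have h1 := hus x b hb1
      obtain ⟨δ, hδ, h2⟩ := Metric.eventually_nhds_iff.1 h1
      obtain ⟨n0, hn0⟩ := exists_nat_ge ((-b) / δ)
      filter_upwards [eventually_ge_atTop n0] with n hn
      refine lt_of_le_of_lt ?_ hb2
      have : Nonempty X := ⟨x⟩
      refine ciSup_le fun y => ?_
      by_cases hy : dist y x < δ
      · have := h2 hy
        have : 0 ≤ (n:ℝ) * dist x y := by positivity
        linarith
      · push Not at hy
        have hnn : (n0 : ℝ) ≤ n := by exact_mod_cast hn
        have h3 : (-b) / δ * δ ≤ n * dist x y := by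
          rw [dist_comm x y]
          refine mul_le_mul (hn0.trans hnn) hy hδ.le (Nat.cast_nonneg _)
        rw [div_mul_cancel₀ _ hδ.ne'] at h3
        linarith [hg0 y]
    have := key.add_const (w x)
    simpa using this

end Dual


section Dual
variable {N d : ℕ} {μ : Fin N → Fin d → Measure ℝ}

/-- admissible continuous dual elements -/
structure Adm (N d : ℕ) (μ : Fin N → Fin d → Measure ℝ) (φ : Fin N → Fin d → ℝ → ℝ)
    (h : (t : ℕ) → Fin d → (Fin t → Fin d → ℝ) → ℝ) : Prop where
  c1 : ∀ t i, Continuous (φ t i)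
  i1 : ∀ t i, Integrable (φ t i) (μ t i)
  c2 : ∀ t i, Continuous (h t i)
  b2 : ∃ M, ∀ t i y, |h t i y| ≤ M

lemma Adm.add {φ φ' : Fin N → Fin d → ℝ → ℝ} {h h' : (t : ℕ) → Fin d → (Fin t → Fin d → ℝ) → ℝ}
    (a : Adm N d μ φ h) (b : Adm N d μ φ' h') : Adm N d μ (φ + φ') (h + h') := by
  refine ⟨fun t i => (a.c1 t i).add (b.c1 t i), fun t i => (a.i1 t i).add (b.i1 t i),
    fun t i => (a.c2 t i).add (b.c2 t i), ?_⟩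
  obtain ⟨M, hM⟩ := a.b2
  obtain ⟨M', hM'⟩ := b.b2
  exact ⟨M + M', fun t i y => (abs_add_le _ _).trans (add_le_add (hM t i y) (hM' t i y))⟩

lemma Adm.smul {φ : Fin N → Fin d → ℝ → ℝ} {h : (t : ℕ) → Fin d → (Fin t → Fin d → ℝ) → ℝ}
    (a : Adm N d μ φ h) (r : ℝ) : Adm N d μ (r • φ) (r • h) := by
  refine ⟨fun t i => (a.c1 t i).const_smul r, fun t i => (a.i1 t i).smul r,
    fun t i => (a.c2 t i).const_smul r, ?_⟩
  obtain ⟨M, hM⟩ := a.b2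
  refine ⟨|r| * M, fun t i y => ?_⟩
  simp only [Pi.smul_apply, smul_eq_mul, abs_mul]
  exact mul_le_mul_of_nonneg_left (hM t i y) (abs_nonneg _)

/-- cost -/
def cost (μ : Fin N → Fin d → Measure ℝ) (φ : Fin N → Fin d → ℝ → ℝ) : ℝ :=
  ∑ t, ∑ i, ∫ y, φ t i y ∂(μ t i)

lemma cost_add {φ φ' : Fin N → Fin d → ℝ → ℝ} (h : ∀ t i, Integrable (φ t i) (μ t i))
    (h' : ∀ t i, Integrable (φ' t i) (μ t i)) : cost μ (φ + φ') = cost μ φ + cost μ φ' := by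
  unfold cost
  simp only [← Finset.sum_add_distrib]
  refine Finset.sum_congr rfl fun t _ => Finset.sum_congr rfl fun i _ => ?_
  exact integral_add (h t i) (h' t i)

lemma cost_smul (r : ℝ) (φ : Fin N → Fin d → ℝ → ℝ) : cost μ (r • φ) = r * cost μ φ := by
  unfold cost
  simp only [Finset.mul_sum]
  refine Finset.sum_congr rfl fun t _ => Finset.sum_congr rfl fun i _ => ?_
  exact integral_const_mul _ _

/-- superhedging costs -/
def Sset (μ : Fin N → Fin d → Measure ℝ) (f : (Fin N → Fin d → ℝ) → ℝ) : Set ℝ :=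
  {r | ∃ φ h, Adm N d μ φ h ∧ (∀ x, f x ≤ payR N d φ h x) ∧ r = cost μ φ}

lemma pay_cost {π : Measure (Fin N → Fin d → ℝ)} (hmom : ∀ t i, Integrable id (μ t i))
    (hπ : π ∈ VMT N d μ) {φ h} (a : Adm N d μ φ h) :
    Integrable (payR N d φ h) π ∧ ∫ x, payR N d φ h x ∂π = cost μ φ := by
  obtain ⟨M, hM⟩ := a.b2
  exact vmt_pay hmom hπ φ h (fun t i => (a.c1 t i).measurable) a.i1
    (fun t i => (a.c2 t i).measurable) M hM

lemma cost_nonneg_of {π : Measure (Fin N → Fin d → ℝ)} (hmom : ∀ t i, Integrable id (μ t i))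
    (hπ : π ∈ VMT N d μ) {φ h} (a : Adm N d μ φ h) (hp : ∀ x, 0 ≤ payR N d φ h x) :
    0 ≤ cost μ φ := by
  rw [← (pay_cost hmom hπ a).2]
  exact integral_nonneg hp

theorem duality (hN : 0 < N) (hd : 0 < d) (hprob : ∀ t i, IsProbabilityMeasure (μ t i))
    (hmom : ∀ t i, Integrable id (μ t i))
    (π : Measure (Fin N → Fin d → ℝ)) (hπ : π ∈ VMT N d μ)
    (c : (Fin N → Fin d → ℝ) → ℝ)
    (hc : UpperSemicontinuous c)
    (v : Fin N → Fin d → ℝ → ℝ)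
    (hv : ∀ t i, Continuous (v t i) ∧ Integrable (v t i) (μ t i))
    (hcbound : ∀ x, |c x| ≤ ∑ t : Fin N, ∑ i : Fin d, v t i (x t i)) :
    ∃ π' ∈ VMT N d μ, ∀ ε > 0, ∃ φ h, Adm N d μ φ h ∧ (∀ x, c x ≤ payR N d φ h x) ∧
      cost μ φ ≤ ∫ x, c x ∂π' + ε := by
  have hcW : c ∈ Wsp N d μ := ⟨v, fun t i => (hv t i).1, fun t i => (hv t i).2, hcbound⟩
  have adm0 : ∀ φ : Fin N → Fin d → ℝ → ℝ, (∀ t i, Continuous (φ t i)) →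
      (∀ t i, Integrable (φ t i) (μ t i)) → Adm N d μ φ 0 := fun φ h1 h2 =>
    ⟨h1, h2, fun t i => continuous_const, ⟨0, fun t i y => by simp⟩⟩
  have hSne : ∀ f ∈ Wsp N d μ, (Sset μ f).Nonempty := by
    rintro f ⟨φ, h1, h2, h3⟩
    refine ⟨cost μ φ, φ, 0, adm0 φ h1 h2, fun x => ?_, rfl⟩
    rw [payR_zero_h]; exact (le_abs_self _).trans (h3 x)
  have hSbdd : ∀ f ∈ Wsp N d μ, BddBelow (Sset μ f) := by
    rintro f ⟨φ, h1, h2, h3⟩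
    refine ⟨-cost μ φ, ?_⟩
    rintro r ⟨ψ, h, ha, hp, rfl⟩
    have := cost_nonneg_of hmom hπ (ha.add (adm0 φ h1 h2)) (fun x => by
      rw [payR_add, payR_zero_h]
      have := (abs_le.1 (h3 x)).1
      have := hp x
      linarith)
    rw [cost_add ha.i1 h2] at this
    linarith
  set p : ((Fin N → Fin d → ℝ) → ℝ) → ℝ := fun f => sInf (Sset μ f) with hp
  have p_le : ∀ f ∈ Wsp N d μ, ∀ φ h, Adm N d μ φ h → (∀ x, f x ≤ payR N d φ h x) → p f ≤ cost μ φ :=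
    fun f hf φ h ha hfp => csInf_le (hSbdd f hf) ⟨φ, h, ha, hfp, rfl⟩
  have p_ex : ∀ f ∈ Wsp N d μ, ∀ ε > 0, ∃ φ h, Adm N d μ φ h ∧ (∀ x, f x ≤ payR N d φ h x) ∧
      cost μ φ < p f + ε := by
    intro f hf ε hε
    obtain ⟨r, ⟨φ, h, ha, hfp, rfl⟩, hr⟩ := exists_lt_of_csInf_lt (hSne f hf) (lt_add_of_pos_right (p f) hε)
    exact ⟨φ, h, ha, hfp, hr⟩
  have p_add : ∀ f ∈ Wsp N d μ, ∀ g ∈ Wsp N d μ, p (f + g) ≤ p f + p g := by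
    intro f hf g hg
    refine le_of_forall_pos_le_add fun ε hε => ?_
    obtain ⟨φ, h, ha, h1, h2⟩ := p_ex f hf (ε/2) (half_pos hε)
    obtain ⟨φ', h', ha', h1', h2'⟩ := p_ex g hg (ε/2) (half_pos hε)
    have := p_le (f + g) ((Wsp N d μ).add_mem hf hg) _ _ (ha.add ha') (fun x => by
      rw [payR_add]; exact add_le_add (h1 x) (h1' x))
    rw [cost_add ha.i1 ha'.i1] at this
    linarith
  have p_smul_le : ∀ r : ℝ, 0 < r → ∀ f ∈ Wsp N d μ, p (r • f) ≤ r * p f := by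
    intro r hr f hf
    refine le_of_forall_pos_le_add fun ε hε => ?_
    obtain ⟨φ, h, ha, h1, h2⟩ := p_ex f hf (ε/r) (div_pos hε hr)
    have := p_le (r • f) ((Wsp N d μ).smul_mem r hf) _ _ (ha.smul r) (fun x => by
      rw [payR_smul]; exact mul_le_mul_of_nonneg_left (h1 x) hr.le)
    rw [cost_smul] at this
    have h3 : r * cost μ φ ≤ r * (p f + ε / r) := mul_le_mul_of_nonneg_left h2.le hr.le
    have h4 : r * (p f + ε / r) = r * p f + ε := by field_simp
    linarith
  have p_smul : ∀ r : ℝ, 0 < r → ∀ f ∈ Wsp N d μ, p (r • f) = r * p f := by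
    intro r hr f hf
    refine le_antisymm (p_smul_le r hr f hf) ?_
    have := p_smul_le r⁻¹ (inv_pos.2 hr) (r • f) ((Wsp N d μ).smul_mem r hf)
    rw [smul_smul, inv_mul_cancel₀ hr.ne', one_smul] at this
    calc r * p f ≤ r * (r⁻¹ * p (r • f)) := mul_le_mul_of_nonneg_left this hr.le
      _ = p (r • f) := by field_simp
  have p_zero : p 0 = 0 := by
    have := p_smul 2 (by norm_num) 0 (Wsp N d μ).zero_mem
    rw [smul_zero] at this; linarith
  have hspan : ∀ r : ℝ, r • (⟨c, hcW⟩ : Wsp N d μ) = 0 → r • p c = 0 := by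
    intro r hr
    by_cases h0 : r = 0
    · simp [h0]
    · have hc0 : (⟨c, hcW⟩ : Wsp N d μ) = 0 := (smul_eq_zero.1 hr).resolve_left h0
      have : c = 0 := congrArg Subtype.val hc0
      rw [this, p_zero, smul_zero]
  obtain ⟨g, hg1, hg2⟩ := exists_extension_of_le_sublinear (E := Wsp N d μ)
    (LinearPMap.mkSpanSingleton' (⟨c, hcW⟩ : Wsp N d μ) (p c) hspan) (fun f => p f.1)
    (fun r hr f => p_smul r hr f.1 f.2) (fun f f' => p_add f.1 f.2 f'.1 f'.2) (by
      rintro ⟨z, hz⟩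
      obtain ⟨r, rfl⟩ := Submodule.mem_span_singleton.1 hz
      rw [LinearPMap.mkSpanSingleton'_apply, smul_eq_mul]
      change r * p c ≤ p (r • c)
      rcases lt_trichotomy r 0 with h | h | h
      · have h1 := p_add (r • c) ((Wsp N d μ).smul_mem r hcW) ((-r) • c) ((Wsp N d μ).smul_mem _ hcW)
        rw [← add_smul, add_neg_cancel, zero_smul, p_zero, p_smul (-r) (by linarith) c hcW] at h1
        linarith
      · simp [h, p_zero]
      · exact (p_smul r h c hcW).ge)
  obtain ⟨l, hl⟩ := LinearMap.exists_extend g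
  have hlg : ∀ f (hf : f ∈ Wsp N d μ), l f = g ⟨f, hf⟩ := fun f hf => by rw [← hl]; rfl
  have hlp : ∀ f ∈ Wsp N d μ, l f ≤ p f := fun f hf => by rw [hlg f hf]; exact hg2 ⟨f, hf⟩
  have hlc : l c = p c := by
    rw [hlg c hcW]
    have := hg1 ⟨⟨c, hcW⟩, Submodule.mem_span_singleton_self _⟩
    refine this.trans ?_
    have := LinearPMap.mkSpanSingleton'_apply_self (R := ℝ) (σ := RingHom.id ℝ) (⟨c, hcW⟩ : Wsp N d μ) (p c) hspan (Submodule.mem_span_singleton_self _)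
    exact this
  have hladm : ∀ φ h, Adm N d μ φ h → payR N d φ h ∈ Wsp N d μ → l (payR N d φ h) = cost μ φ := by
    intro φ h ha hW
    refine le_antisymm ((hlp _ hW).trans (p_le _ hW φ h ha fun x => le_rfl)) ?_
    have h1 := (hlp _ ((Wsp N d μ).neg_mem hW)).trans (p_le _ ((Wsp N d μ).neg_mem hW) _ _ (ha.smul (-1)) fun x => by
      rw [payR_smul]; simp)
    rw [map_neg, cost_smul] at h1
    linarith
  have hpos : ∀ f ∈ Wsp N d μ, (∀ x, 0 ≤ f x) → 0 ≤ l f := by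
    intro f hf h0
    have h1 := (hlp _ ((Wsp N d μ).neg_mem hf)).trans (p_le _ ((Wsp N d μ).neg_mem hf) 0 0
      (adm0 0 (fun t i => continuous_const) (fun t i => integrable_zero _ _ _)) fun x => by
        rw [payR_zero_h]; simp [h0 x])
    have h2 : cost μ (0 : Fin N → Fin d → ℝ → ℝ) = 0 := by simp [cost]
    rw [map_neg, h2] at h1
    linarith
  have hmarg : ∀ t i (φ : ℝ → ℝ), Continuous φ → Integrable φ (μ t i) →
      l (fun x => φ (x t i)) = ∫ y, φ y ∂(μ t i) := by
    intro t i φ h1 h2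
    have e : (fun x : Fin N → Fin d → ℝ => φ (x t i)) =
        payR N d (fun s j => if s = t ∧ j = i then φ else 0) 0 := by
      ext x; rw [payR_zero_h, sum_single_ev]
    have hW := Wsp_ev (μ := μ) t i φ h1 h2
    rw [e] at hW
    have ha : Adm N d μ (fun s j => if s = t ∧ j = i then φ else 0) 0 := by
      refine adm0 _ ?_ ?_
      · intro s j
        split_ifs
        · exact h1
        · exact continuous_const
      · intro s j
        split_ifs with h
        · obtain ⟨rfl, rfl⟩ := h; exact h2
        · exact integrable_zero _ _ _
    rw [e, hladm _ _ ha hW]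
    rw [← (pay_cost hmom hπ ha).2, ← e]
    exact vmt_integral hπ t i φ h1.measurable
  obtain ⟨π', hπ'⟩ := riesz_rep hN hd hprob hmom l hpos hmarg
  have hmass : IsProbabilityMeasure π' := by
    have h1 := hπ' _ (Wsp_ev (μ := μ) ⟨0, hN⟩ ⟨0, hd⟩ (fun _ => 1) continuous_const (integrable_const _)) continuous_const
    have h2 := hmarg ⟨0, hN⟩ ⟨0, hd⟩ (fun _ => 1) continuous_const (integrable_const _)
    have h3 := h1.2.trans h2
    simp only [integral_const, smul_eq_mul, mul_one, probReal_univ] at h3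
    exact ⟨by
      have h4 : π' Set.univ = 1 := by
        rw [Measure.real] at h3
        rw [← ENNReal.toReal_eq_one_iff]; exact h3
      exact h4⟩
  have hmem : π' ∈ VMT N d μ := by
    refine mem_VMT_of π' hmom ?_ ?_
    · intro t i
      have : IsFiniteMeasure (π'.map fun x => x t i) := inferInstance
      refine ext_of_forall_integral_eq_of_IsFiniteMeasure fun f => ?_
      rw [integral_map (meas_ev t i).aemeasurable f.continuous.aestronglyMeasurable]
      have hfi : Integrable f (μ t i) := f.integrable _
      rw [← hmarg t i f f.continuous hfi]
      exact (hπ' _ (Wsp_ev t i f f.continuous hfi) (f.continuous.comp (cont_ev t i))).2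
    · intro t ht i h
      let H : (s : ℕ) → Fin d → (Fin s → Fin d → ℝ) → ℝ := fun s j y =>
        if hs : t + 1 = s then (if j = i then h (fun a => y (a.cast hs)) else 0) else 0
      have ha : Adm N d μ 0 H := by
        refine ⟨fun t i => continuous_const, fun t i => integrable_zero _ _ _, ?_, ⟨‖h‖, ?_⟩⟩
        · intro s j
          by_cases hs : t + 1 = s
          · subst hs
            by_cases hj : j = i
            · simp only [H, hj, dif_pos, if_true]
              exact h.continuous
            · simp only [H, hj, dif_pos, if_false]
              exact continuous_const
          · simp only [H, hs, dif_neg, not_false_eq_true]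
            exact continuous_const
        · intro s j y
          simp only [H]
          split_ifs
          · exact h.norm_coe_le_norm _
          · simp
          · simp
      have e : payR N d 0 H = fun x : Fin N → Fin d → ℝ => h (fun s => x ⟨s.val, by have := s.isLt; omega⟩) *
        (x ⟨t + 1, ht⟩ i - x ⟨t, by omega⟩ i) := by
        ext x
        unfold payR
        rw [Finset.sum_eq_single ⟨t, by omega⟩, Finset.sum_eq_single i]
        · simp [H, ht]
        · intro j _ hj; simp [H, hj]
        · simp
        · intro s _ hs
          have : t ≠ (s : ℕ) := fun hcon => hs (Fin.ext hcon.symm)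
          simp [H, this]
        · simp
      have hW : payR N d 0 H ∈ Wsp N d μ := by
        have hc1 : ∀ s : Fin N, (fun x : Fin N → Fin d → ℝ => |x s i|) ∈ Wsp N d μ := fun s =>
          Wsp_ev s i (fun y => |y|) continuous_abs (hmom s i).abs
        refine Wsp_mono (g := ‖h‖ • ((fun x : Fin N → Fin d → ℝ => |x ⟨t+1, ht⟩ i|) + (fun x => |x ⟨t, by omega⟩ i|)))
          ((Wsp N d μ).smul_mem _ ((Wsp N d μ).add_mem (hc1 _) (hc1 _))) fun x => ?_
        rw [e]
        simp only [Pi.smul_apply, Pi.add_apply, smul_eq_mul, abs_mul]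
        exact mul_le_mul (h.norm_coe_le_norm _) (abs_sub _ _) (abs_nonneg _) (norm_nonneg _)
      have h1 := hladm 0 H ha hW
      have h2 : cost μ (0 : Fin N → Fin d → ℝ → ℝ) = 0 := by simp [cost]
      rw [h2, ← (hπ' _ hW (by
        rw [e]
        exact (h.continuous.comp (cont_restr _)).mul ((cont_ev _ _).sub (cont_ev _ _)))).2, e] at h1
      exact h1
  refine ⟨π', hmem, fun ε hε => ?_⟩
  obtain ⟨φ, h, ha, h1, h2⟩ := p_ex c hcW ε hε
  refine ⟨φ, h, ha, h1, h2.le.trans ?_⟩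
  have hwc : Continuous fun x : Fin N → Fin d → ℝ => ∑ t : Fin N, ∑ i : Fin d, v t i (x t i) :=
    continuous_finsetSum _ fun t _ => continuous_finsetSum _ fun i _ => (hv t i).1.comp (cont_ev t i)
  have hwW : (fun x : Fin N → Fin d → ℝ => ∑ t : Fin N, ∑ i : Fin d, v t i (x t i)) ∈ Wsp N d μ :=
    ⟨v, fun t i => (hv t i).1, fun t i => (hv t i).2, fun x => by
      rw [abs_of_nonneg ((abs_nonneg _).trans (hcbound x))]⟩
  obtain ⟨f, f1, f2, f3, f4⟩ := usc_approx c _ hc hwc hcbound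
  have hlim : Tendsto (fun n => ∫ x, f n x ∂π') atTop (nhds (∫ x, c x ∂π')) := by
    refine tendsto_integral_of_dominated_convergence _ (fun n => (f1 n).aestronglyMeasurable)
      (hπ' _ hwW hwc).1 (fun n => Eventually.of_forall fun x => f3 n x) (Eventually.of_forall f4)
  have hge : ∀ n, p c ≤ ∫ x, f n x ∂π' := by
    intro n
    have hfW : f n ∈ Wsp N d μ := Wsp_mono hwW (f3 n)
    rw [(hπ' _ hfW (f1 n)).2, ← hlc]
    have := hpos (f n - c) ((Wsp N d μ).sub_mem hfW hcW) (fun x => sub_nonneg.2 (f2 n x))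
    rw [map_sub] at this; linarith
  have := ge_of_tendsto' hlim hge
  linarith

end Dual


lemma sup_affine_subgrad {ι : Type*} [Nonempty ι] (α β : ι → ℝ) (M : ℝ) (hβ : ∀ z, |β z| ≤ M)
    (hb : ∀ y, BddAbove (Set.range fun z => α z + β z * y)) :
    ∃ q : ℝ → ℝ, (∀ x, |q x| ≤ M) ∧ ∀ x y, (⨆ z, (α z + β z * x)) + q x * (y - x) ≤ ⨆ z, (α z + β z * y) := by
  have key : ∀ x, ∃ q : ℝ, |q| ≤ M ∧ ∀ y, (⨆ z, (α z + β z * x)) + q * (y - x) ≤ ⨆ z, (α z + β z * y) := by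
    intro x
    have h1 : ∀ k : ℕ, ∃ z, (⨆ z, (α z + β z * x)) - 1 / ((k : ℝ) + 1) < α z + β z * x := fun k =>
      exists_lt_of_lt_ciSup (by have : 0 < 1 / ((k : ℝ) + 1) := by positivity
                                linarith)
    choose z hz using h1
    obtain ⟨q, hq, σ, hσ, hlim⟩ := (isCompact_Icc (a := -M) (b := M)).tendsto_subseq
      (x := fun k => β (z k)) (fun k => abs_le.1 (hβ _))
    refine ⟨q, abs_le.2 hq, fun y => ?_⟩
    have t1 : Tendsto (fun k => (⨆ z, (α z + β z * x)) - 1 / (((σ k : ℕ) : ℝ) + 1) + β (z (σ k)) * (y - x)) atTop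
        (nhds ((⨆ z, (α z + β z * x)) - 0 + q * (y - x))) :=
      ((tendsto_const_nhds.sub (tendsto_one_div_add_atTop_nhds_zero_nat.comp hσ.tendsto_atTop)).add
        (hlim.mul_const _))
    rw [sub_zero] at t1
    refine le_of_tendsto t1 (Eventually.of_forall fun k => ?_)
    have h2 := le_ciSup (hb y) (z (σ k))
    have h3 := hz (σ k)
    nlinarith
  choose q h1 h2 using key
  exact ⟨q, h1, h2⟩

lemma conv1 (M : ℝ) (n : ℕ) : ∀ (f : ℕ → ℝ → ℝ) (H : ℕ → (ℕ → ℝ) → ℝ),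
    (∀ t z z', (∀ s ≤ t, z s = z' s) → H t z = H t z') → (∀ t z, |H t z| ≤ M) →
    (∀ z : ℕ → ℝ, 0 ≤ ∑ t ∈ Finset.range (n + 1), f t (z t) +
      ∑ t ∈ Finset.range n, H t z * (z (t + 1) - z t)) →
    ∃ χ q : ℕ → ℝ → ℝ, (χ 0 = 0) ∧ (q 0 = 0) ∧ (∀ s, n < s → χ s = 0 ∧ q s = 0) ∧
      (∀ s x y, χ s x + q s x * (y - x) ≤ χ s y) ∧ (∀ s x, |q s x| ≤ M) ∧
      ∀ t ≤ n, ∀ x, χ t x ≤ f t x + χ (t + 1) x := by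
  induction n with
  | zero =>
    intro f H had hM hp
    refine ⟨0, 0, rfl, rfl, fun s _ => ⟨rfl, rfl⟩, by simp, fun s x => ?_, ?_⟩
    · simpa using (abs_nonneg _).trans (hM 0 0)
    · intro t ht x
      obtain rfl : t = 0 := by omega
      simpa using hp (fun _ => x)
  | succ n ih =>
    intro f H had hM hp
    set B : (ℕ → ℝ) → ℝ := fun z => ∑ t ∈ Finset.range (n + 1), f t (z t) +
      ∑ t ∈ Finset.range n, H t z * (z (t + 1) - z t) with hB
    set α : (ℕ → ℝ) → ℝ := fun z => - B z + H n z * z n with hα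
    set β : (ℕ → ℝ) → ℝ := fun z => - H n z with hβ
    have hle : ∀ y z, α z + β z * y ≤ f (n + 1) y := by
      intro y z
      have h1 := hp (Function.update z (n + 1) y)
      rw [Finset.sum_range_succ, Finset.sum_range_succ (fun t => H t (Function.update z (n + 1) y) * _)] at h1
      have e1 : ∀ s ≤ n, Function.update z (n + 1) y s = z s := fun s hs =>
        Function.update_of_ne (by omega) _ _
      have e2 : ∀ t ≤ n, H t (Function.update z (n + 1) y) = H t z := fun t ht =>
        had t _ _ fun s hs => e1 s (hs.trans ht)
      have e3 : ∑ t ∈ Finset.range (n + 1), f t (Function.update z (n + 1) y t) =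
          ∑ t ∈ Finset.range (n + 1), f t (z t) := Finset.sum_congr rfl fun t ht => by
        rw [e1 t (by have := Finset.mem_range.1 ht; omega)]
      have e4 : ∑ t ∈ Finset.range n, H t (Function.update z (n + 1) y) *
          (Function.update z (n + 1) y (t + 1) - Function.update z (n + 1) y t) =
          ∑ t ∈ Finset.range n, H t z * (z (t + 1) - z t) := Finset.sum_congr rfl fun t ht => by
        have := Finset.mem_range.1 ht
        rw [e1 t (by omega), e1 (t + 1) (by omega), e2 t (by omega)]
      rw [e3, e4, e2 n le_rfl, e1 n le_rfl, Function.update_self] at h1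
      simp only [hα, hβ, hB]
      linarith
    have hb : ∀ y, BddAbove (Set.range fun z => α z + β z * y) := fun y =>
      ⟨f (n + 1) y, by rintro _ ⟨z, rfl⟩; exact hle y z⟩
    obtain ⟨q₁, hq1, hq2⟩ := sup_affine_subgrad α β M (fun z => by simpa [hβ] using hM n z) hb
    set χ₁ : ℝ → ℝ := fun y => ⨆ z, (α z + β z * y) with hχ₁
    have hχf : ∀ y, χ₁ y ≤ f (n + 1) y := fun y => ciSup_le (hle y)
    obtain ⟨χ, q, h1, h2, h3, h4, h5, h6⟩ := ih (fun t => if t = n then fun x => f n x + χ₁ x else f t) H had hM (by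
      intro z
      have : α z + β z * z n ≤ χ₁ (z n) := le_ciSup (hb (z n)) z
      rw [Finset.sum_range_succ]
      simp only [if_true]
      have e : ∑ t ∈ Finset.range n, (if t = n then fun x => f n x + χ₁ x else f t) (z t) =
          ∑ t ∈ Finset.range n, f t (z t) := Finset.sum_congr rfl fun t ht => by
        rw [if_neg (by have := Finset.mem_range.1 ht; omega)]
      rw [e]
      simp only [hα, hβ, hB, Finset.sum_range_succ] at this
      linarith)
    refine ⟨Function.update χ (n + 1) χ₁, Function.update q (n + 1) q₁, ?_, ?_, ?_, ?_, ?_, ?_⟩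
    · rw [Function.update_of_ne (by omega)]; exact h1
    · rw [Function.update_of_ne (by omega)]; exact h2
    · intro s hs
      rw [Function.update_of_ne (by omega), Function.update_of_ne (by omega)]
      exact h3 s (by omega)
    · intro s x y
      by_cases hs : s = n + 1
      · subst hs; simp only [Function.update_self]; exact hq2 x y
      · rw [Function.update_of_ne hs, Function.update_of_ne hs]; exact h4 s x y
    · intro s x
      by_cases hs : s = n + 1
      · subst hs; simp only [Function.update_self]; exact hq1 x
      · rw [Function.update_of_ne hs]; exact h5 s x
    · intro t ht x
      by_cases h : t = n + 1
      · subst h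
        rw [Function.update_self, Function.update_of_ne (by omega), (h3 (n + 2) (by omega)).1]
        simpa using hχf x
      · rw [Function.update_of_ne h]
        have h7 := h6 t (by omega) x
        by_cases h' : t = n
        · subst h'
          rw [Function.update_self]
          rw [(h3 (t + 1) (by omega)).1] at h7
          simpa using h7
        · rw [Function.update_of_ne (by omega)]
          simpa [h'] using h7

/-- regularity from the subgradient inequality -/
lemma subgrad_reg {χ q : ℝ → ℝ} (h : ∀ x y, χ x + q x * (y - x) ≤ χ y) {M : ℝ} (hM : ∀ x, |q x| ≤ M) :
    Continuous χ ∧ Measurable q ∧ ∀ x y, |χ x - χ y| ≤ M * |x - y| := by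
  have hL : ∀ x y, |χ x - χ y| ≤ M * |x - y| := by
    intro x y
    have h1 := h x y
    have h2 := h y x
    have b1 : |q x * (y - x)| ≤ M * |x - y| := by
      rw [abs_mul, abs_sub_comm y x]; exact mul_le_mul_of_nonneg_right (hM x) (abs_nonneg _)
    have b2 : |q y * (x - y)| ≤ M * |x - y| := by
      rw [abs_mul]; exact mul_le_mul_of_nonneg_right (hM y) (abs_nonneg _)
    rw [abs_le] at *
    constructor <;> linarith
  have hM0 : 0 ≤ M := (abs_nonneg _).trans (hM 0)
  refine ⟨?_, ?_, hL⟩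
  · refine (LipschitzWith.of_dist_le_mul (K := ⟨M, hM0⟩) fun x y => ?_).continuous
    rw [Real.dist_eq, Real.dist_eq]; exact hL x y
  · refine Monotone.measurable fun x y hxy => ?_
    rcases hxy.eq_or_lt with rfl | hlt
    · rfl
    · have h1 := h x y
      have h2 := h y x
      by_contra hc
      push Not at hc
      nlinarith


lemma ae_summable_of {Ω : Type*} [MeasurableSpace Ω] {P : Measure Ω} (f : ℕ → Ω → ℝ)
    (hf : ∀ n, Integrable (f n) P) (h0 : ∀ n, 0 ≤ᵐ[P] f n) (b : ℕ → ℝ) (hb : Summable b)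
    (hfb : ∀ n, ∫ ω, f n ω ∂P ≤ b n) : ∀ᵐ ω ∂P, Summable fun n => f n ω := by
  have hs : Summable fun n => ∫ ω, f n ω ∂P :=
    Summable.of_nonneg_of_le (fun n => integral_nonneg_of_ae (h0 n)) hfb hb
  have h1 : ∫⁻ ω, ∑' n, ENNReal.ofReal (f n ω) ∂P ≠ ⊤ := by
    rw [lintegral_tsum fun n => (hf n).aestronglyMeasurable.aemeasurable.ennreal_ofReal]
    have : ∀ n, ∫⁻ ω, ENNReal.ofReal (f n ω) ∂P = ENNReal.ofReal (∫ ω, f n ω ∂P) := fun n =>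
      (ofReal_integral_eq_lintegral_ofReal (hf n) (h0 n)).symm
    simp only [this]
    exact hs.tsum_ofReal_ne_top
  have h2 := ae_lt_top' (AEMeasurable.tsum fun n => (hf n).aestronglyMeasurable.aemeasurable.ennreal_ofReal) h1
  filter_upwards [h2, ae_all_iff.2 h0] with ω h2 h0
  have h3 := ENNReal.summable_toReal h2.ne
  refine h3.congr fun n => ?_
  exact (ENNReal.toReal_ofReal (h0 n))

lemma komlos {E Ω κ : Type*} [Fintype κ] [MeasurableSpace Ω] (P : Measure Ω) [IsProbabilityMeasure P]
    (K : ℕ → Set E) (hanti : Antitone K) (hne : ∀ n, (K n).Nonempty) (mid : E → E → E)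
    (hmid : ∀ n e e', e ∈ K n → e' ∈ K n → mid e e' ∈ K n)
    (F : κ → E → Ω → ℝ) (hFm : ∀ e ∈ K 0, ∀ k, Measurable (F k e))
    (hF0 : ∀ e ∈ K 0, ∀ k ω, 0 ≤ F k e ω)
    (hFmid : ∀ e ∈ K 0, ∀ e' ∈ K 0, ∀ k ω, F k (mid e e') ω = (F k e ω + F k e' ω) / 2) :
    ∃ e : ℕ → E, (∀ n, e n ∈ K n) ∧ ∀ k, ∀ᵐ ω ∂P, ∃ l : ℝ,
      Tendsto (fun n => Real.exp (-(F k (e n) ω) / 2)) atTop (nhds l) := by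
  have hK0 : ∀ {n e}, e ∈ K n → e ∈ K 0 := fun h => hanti (Nat.zero_le _) h
  set J : E → ℝ := fun e => ∑ k, ∫ ω, Real.exp (-(F k e ω)) ∂P with hJ
  have hei : ∀ e ∈ K 0, ∀ k, Integrable (fun ω => Real.exp (-(F k e ω))) P := fun e he k =>
    Integrable.of_bound (C := 1) (((hFm e he k).neg.exp).aestronglyMeasurable) (Eventually.of_forall fun ω => by
      rw [Real.norm_eq_abs, abs_of_pos (Real.exp_pos _)]
      exact Real.exp_le_one_iff.2 (by have := hF0 e he k ω; linarith))
  have hJ0 : ∀ e, 0 ≤ J e := fun e => Finset.sum_nonneg fun k _ => integral_nonneg fun ω => (Real.exp_pos _).le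
  have hJ1 : ∀ e ∈ K 0, J e ≤ Fintype.card κ := fun e he => by
    have : ∀ k ∈ Finset.univ, ∫ ω, Real.exp (-(F k e ω)) ∂P ≤ 1 := fun k _ => by
      have := integral_mono (hei e he k) (integrable_const (1:ℝ)) fun ω =>
        Real.exp_le_one_iff.2 (by have := hF0 e he k ω; linarith)
      simpa using this
    simpa using Finset.sum_le_sum this
  set Jn : ℕ → ℝ := fun n => sInf (J '' K n) with hJn
  have hbdd : ∀ n, BddBelow (J '' K n) := fun n => ⟨0, by rintro _ ⟨e, _, rfl⟩; exact hJ0 e⟩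
  have hJnle : ∀ n e, e ∈ K n → Jn n ≤ J e := fun n e he => csInf_le (hbdd n) ⟨e, he, rfl⟩
  have hmono : Monotone Jn := fun n m hnm =>
    csInf_le_csInf (hbdd n) ((hne m).image J) (Set.image_mono (hanti hnm))
  have hJnb : BddAbove (Set.range Jn) := ⟨Fintype.card κ, by
    rintro _ ⟨n, rfl⟩
    obtain ⟨e, he⟩ := hne n
    exact (hJnle n e he).trans (hJ1 e (hK0 he))⟩
  have hlim := tendsto_atTop_ciSup hmono hJnb
  set Ji := ⨆ n, Jn n with hJi
  have hJnJi : ∀ n, Jn n ≤ Ji := fun n => le_ciSup hJnb n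
  obtain ⟨σ, hσ, hσJ⟩ := extraction_forall_of_eventually (P := fun k n => Ji - (1/4 : ℝ)^k < Jn n)
    (fun k => hlim.eventually (lt_mem_nhds (by
      have : (0:ℝ) < (1/4)^k := by positivity
      linarith)))
  have hex : ∀ k, ∃ e ∈ K (σ k), J e < Jn (σ k) + (1/4 : ℝ)^k := fun k => by
    obtain ⟨_, ⟨e, he, rfl⟩, h⟩ := exists_lt_of_csInf_lt ((hne (σ k)).image J)
      (lt_add_of_pos_right (Jn (σ k)) (show (0:ℝ) < (1/4)^k by positivity))
    exact ⟨e, he, h⟩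
  choose e heK heJ using hex
  refine ⟨e, fun n => hanti (hσ.id_le n) (heK n), ?_⟩
  set u : κ → ℕ → Ω → ℝ := fun k n ω => Real.exp (-(F k (e n) ω) / 2) with hu
  have hu1 : ∀ k n ω, 0 ≤ u k n ω ∧ u k n ω ≤ 1 := fun k n ω => ⟨(Real.exp_pos _).le,
    Real.exp_le_one_iff.2 (by have := hF0 _ (hK0 (heK n)) k ω; linarith)⟩
  have hum : ∀ k n, Measurable (u k n) := fun k n =>
    (((hFm _ (hK0 (heK n)) k).neg.div_const 2)).exp
  have hd2i : ∀ k n, Integrable (fun ω => (u k n ω - u k (n+1) ω)^2) P := fun k n =>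
    Integrable.of_bound (C := 1) (((hum k n).sub (hum k (n+1))).pow_const 2).aestronglyMeasurable
      (Eventually.of_forall fun ω => by
        rw [Real.norm_eq_abs, abs_of_nonneg (sq_nonneg _)]
        have h1 := hu1 k n ω
        have h2 := hu1 k (n+1) ω
        rw [sq_le_one_iff_abs_le_one, abs_le]
        constructor <;> linarith)
  have hdi : ∀ k n, Integrable (fun ω => |u k n ω - u k (n+1) ω|) P := fun k n =>
    Integrable.of_bound (C := 1) (((hum k n).sub (hum k (n+1))).abs).aestronglyMeasurable
      (Eventually.of_forall fun ω => by
        rw [Real.norm_eq_abs, abs_abs]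
        have h1 := hu1 k n ω
        have h2 := hu1 k (n+1) ω
        rw [abs_le]
        constructor <;> linarith)
  have hsq : ∀ n, ∑ k, ∫ ω, (u k n ω - u k (n+1) ω)^2 ∂P ≤ 4 * (1/4 : ℝ)^n := by
    intro n
    have hn' : e (n+1) ∈ K (σ n) := hanti (hσ.monotone (Nat.le_succ n)) (heK (n+1))
    have h1 := hJnle _ _ (hmid _ _ _ (heK n) hn')
    have h2 : J (mid (e n) (e (n+1))) = (J (e n) + J (e (n+1)))/2 -
        (∑ k, ∫ ω, (u k n ω - u k (n+1) ω)^2 ∂P)/2 := by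
      simp only [hJ]
      rw [← Finset.sum_add_distrib, Finset.sum_div, Finset.sum_div, ← Finset.sum_sub_distrib]
      refine Finset.sum_congr rfl fun k _ => ?_
      rw [← integral_add (hei _ (hK0 (heK n)) k) (hei _ (hK0 (heK (n+1))) k), ← integral_div, ← integral_div]
      refine Eq.trans ?_ (integral_sub (((hei _ (hK0 (heK n)) k).add (hei _ (hK0 (heK (n+1))) k)).div_const 2)
        ((hd2i k n).div_const 2))
      refine integral_congr_ae (Eventually.of_forall fun ω => ?_)
      simp only [hu, Pi.add_apply]
      rw [hFmid _ (hK0 (heK n)) _ (hK0 (heK (n+1)))]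
      have a1 : Real.exp (-(F k (e n) ω)) = Real.exp (-(F k (e n) ω)/2) ^ 2 := by
        rw [← Real.exp_nat_mul]; congr 1; push_cast; ring
      have a2 : Real.exp (-(F k (e (n+1)) ω)) = Real.exp (-(F k (e (n+1)) ω)/2) ^ 2 := by
        rw [← Real.exp_nat_mul]; congr 1; push_cast; ring
      have a3 : Real.exp (-((F k (e n) ω + F k (e (n+1)) ω)/2)) =
          Real.exp (-(F k (e n) ω)/2) * Real.exp (-(F k (e (n+1)) ω)/2) := by
        rw [← Real.exp_add]; congr 1; ring
      rw [a1, a2, a3]; ring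
    have h3 := heJ n
    have h4 := heJ (n+1)
    have h5 := hσJ n
    have h6 := hJnJi (σ n)
    have h7 := hJnJi (σ (n+1))
    have h8 : (1/4 : ℝ)^(n+1) = (1/4)^n / 4 := by rw [pow_succ]; ring
    have h9 : (0:ℝ) < (1/4)^n := by positivity
    rw [h8] at h4
    rw [h2] at h1
    linarith
  intro k
  have hdk : ∀ n, ∫ ω, |u k n ω - u k (n+1) ω| ∂P ≤ 5/2 * (1/2 : ℝ)^n := by
    intro n
    have h1 : ∫ ω, (u k n ω - u k (n+1) ω)^2 ∂P ≤ 4 * (1/4 : ℝ)^n :=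
      (Finset.single_le_sum (f := fun k => ∫ ω, (u k n ω - u k (n+1) ω)^2 ∂P)
        (fun k _ => integral_nonneg fun ω => sq_nonneg _) (Finset.mem_univ k)).trans (hsq n)
    have h2 : ∫ ω, |u k n ω - u k (n+1) ω| ∂P ≤
        ∫ ω, ((1/2 : ℝ)^n / 2 + 2^n / 2 * (u k n ω - u k (n+1) ω)^2) ∂P := by
      refine integral_mono (hdi k n) ((integrable_const _).add ((hd2i k n).const_mul _)) fun ω => ?_
      have hp : (0:ℝ) < 2^n := by positivity
      have e1 : (1/2 : ℝ)^n = (2^n)⁻¹ := by rw [one_div, inv_pow]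
      dsimp only
      rw [e1, ← sq_abs (u k n ω - u k (n+1) ω)]
      set a := |u k n ω - u k (n+1) ω|
      have : (2^n : ℝ)⁻¹ / 2 + 2^n/2 * a^2 - a = (2^n : ℝ)⁻¹ / 2 * (1 - 2^n * a)^2 := by field_simp; ring
      have : 0 ≤ (2^n : ℝ)⁻¹ / 2 * (1 - 2^n * a)^2 := by positivity
      linarith
    rw [integral_add (integrable_const _) ((hd2i k n).const_mul _), integral_const_mul] at h2
    simp only [integral_const, probReal_univ, one_smul] at h2
    have h3 : (2:ℝ)^n / 2 * (4 * (1/4 : ℝ)^n) = 2 * (1/2)^n := by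
      have : (1/4 : ℝ)^n = (1/2)^n * (1/2)^n := by rw [← mul_pow]; norm_num
      rw [this]
      have : (2:ℝ)^n * (1/2)^n = 1 := by rw [← mul_pow]; norm_num
      linear_combination (2 * (1/2:ℝ)^n) * this
    have h4 := mul_le_mul_of_nonneg_left h1 (show (0:ℝ) ≤ 2^n/2 by positivity)
    linarith
  have hsum := ae_summable_of (fun n ω => |u k n ω - u k (n+1) ω|) (hdi k)
    (fun n => Eventually.of_forall fun ω => abs_nonneg _) _
    ((summable_geometric_of_lt_one (by norm_num) (by norm_num : (1/2:ℝ) < 1)).mul_left (5/2)) hdk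
  filter_upwards [hsum] with ω hω
  have : CauchySeq fun n => u k n ω := cauchySeq_of_summable_dist (by simpa [Real.dist_eq] using hω)
  exact cauchySeq_tendsto_of_complete this

/-- bounded nonneg sequence with convergent exponentials converges -/
lemma tendsto_of_exp_bdd {a : ℕ → ℝ} {l : ℝ} (h : Tendsto (fun n => Real.exp (-(a n) / 2)) atTop (nhds l))
    (hl : l ≠ 0) : ∃ b, Tendsto a atTop (nhds b) := by
  refine ⟨-2 * Real.log l, ?_⟩
  have := ((Real.continuousAt_log hl).tendsto.comp h).const_mul (-2)
  refine this.congr fun n => ?_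
  simp only [Function.comp, Real.log_exp]; ring

lemma tendsto_of_exp_bdd' {a : ℕ → ℝ} {l C : ℝ} (h : Tendsto (fun n => Real.exp (-(a n) / 2)) atTop (nhds l))
    (hl : ∀ n, a n ≤ C) : ∃ b, Tendsto a atTop (nhds b) := by
  refine tendsto_of_exp_bdd h (ne_of_gt ?_)
  have : Real.exp (-C/2) ≤ l := ge_of_tendsto h (Eventually.of_forall fun n =>
    Real.exp_le_exp.2 (by have := hl n; linarith))
  exact (Real.exp_pos _).trans_le this

lemma ae_tendsto_of_exp {Ω : Type*} [MeasurableSpace Ω] {P : Measure Ω} (f : ℕ → Ω → ℝ)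
    (hf : ∀ n, Integrable (f n) P) (hm : ∀ n, Measurable (f n)) (h0 : ∀ n ω, 0 ≤ f n ω) (C : ℝ)
    (hC : ∀ n, ∫ ω, f n ω ∂P ≤ C)
    (h : ∀ᵐ ω ∂P, ∃ l : ℝ, Tendsto (fun n => Real.exp (-(f n ω) / 2)) atTop (nhds l)) :
    ∀ᵐ ω ∂P, ∃ b, Tendsto (fun n => f n ω) atTop (nhds b) := by
  have h1 : ∫⁻ ω, liminf (fun n => ENNReal.ofReal (f n ω)) atTop ∂P ≠ ⊤ := by
    refine ne_top_of_le_ne_top (b := ENNReal.ofReal C) ENNReal.ofReal_ne_top ?_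
    refine (lintegral_liminf_le fun n => (hm n).ennreal_ofReal).trans ?_
    refine (liminf_le_liminf (Eventually.of_forall fun n => ?_) (v := fun _ => ENNReal.ofReal C)).trans (by simp)
    rw [← ofReal_integral_eq_lintegral_ofReal (hf n) (Eventually.of_forall (h0 n))]
    exact ENNReal.ofReal_le_ofReal (hC n)
  have h2 := ae_lt_top (Measurable.liminf fun n => (hm n).ennreal_ofReal) h1
  filter_upwards [h2, h] with ω h2 h
  obtain ⟨l, hl⟩ := h
  refine tendsto_of_exp_bdd hl fun h0 => ?_
  subst h0
  have h3 : Tendsto (fun n => -(f n ω)/2) atTop atBot := Real.tendsto_exp_comp_nhds_zero.1 hl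
  have h4 : Tendsto (fun n => f n ω) atTop atTop := by
    have := h3.const_mul_atBot_of_neg (show (-2:ℝ) < 0 by norm_num)
    refine this.congr fun n => by ring
  have h5 := (ENNReal.tendsto_ofReal_atTop.comp h4).liminf_eq
  have h6 : liminf (fun n => ENNReal.ofReal (f n ω)) atTop = ⊤ := h5
  rw [h6] at h2
  exact lt_irrefl _ h2


lemma tele {N : ℕ} (χ : ℕ → ℝ → ℝ) (h0 : χ 0 = 0) (hN : χ N = 0) (x : Fin N → ℝ) :
    ∑ t : Fin N, (- χ t (x t) + χ ((t : ℕ) + 1) (x t) +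
      (if h : (t : ℕ) + 1 < N then χ ((t : ℕ) + 1) (x ⟨(t : ℕ) + 1, h⟩) - χ ((t : ℕ) + 1) (x t) else 0)) = 0 := by
  set B : ℕ → ℝ := fun t => if h : t < N then χ t (x ⟨t, h⟩) else 0 with hB
  have h1 : ∀ t : Fin N, (- χ t (x t) + χ ((t : ℕ) + 1) (x t) +
      (if h : (t : ℕ) + 1 < N then χ ((t : ℕ) + 1) (x ⟨(t : ℕ) + 1, h⟩) - χ ((t : ℕ) + 1) (x t) else 0)) =
      B ((t : ℕ) + 1) - B t := by
    intro t
    simp only [hB, t.isLt, dif_pos]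
    by_cases h : (t : ℕ) + 1 < N
    · simp only [h, dif_pos]; ring
    · have : (t : ℕ) + 1 = N := by have := t.isLt; omega
      simp only [h, dif_neg, not_false_eq_true]
      rw [this, hN]; simp
  rw [Finset.sum_congr rfl fun t _ => h1 t, Fin.sum_univ_eq_sum_range (fun t => B (t + 1) - B t),
    Finset.sum_range_sub]
  simp [hB, h0]

section
variable {N d : ℕ} {μ : Fin N → Fin d → Measure ℝ} {π : Measure (Fin N → Fin d → ℝ)}

/-- substitution of one coordinate path -/
def subst {d m : ℕ} (i : Fin d) (z : ℕ → ℝ) (x : Fin m → Fin d → ℝ) : Fin m → Fin d → ℝ :=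
  fun t j => if j = i then z t else x t j

lemma subst_meas {m : ℕ} (i : Fin d) (z : ℕ → ℝ) : Measurable (subst (m := m) i z) := by
  refine measurable_pi_lambda _ fun t => measurable_pi_lambda _ fun j => ?_
  unfold subst
  by_cases h : j = i
  · simp only [h, if_true]; exact measurable_const
  · simp only [h, if_false]; exact meas_ev t j

/-- averaged hedge -/
def Hav (π : Measure (Fin N → Fin d → ℝ)) (h : (t : ℕ) → Fin d → (Fin t → Fin d → ℝ) → ℝ) (i : Fin d)
    (t : ℕ) (z : ℕ → ℝ) : ℝ :=
  if ht : t + 1 < N then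
    ∫ x : Fin N → Fin d → ℝ, h (t + 1) i (subst i z (fun s : Fin (t + 1) => x ⟨s.val, by have := s.isLt; omega⟩)) ∂π
  else 0

lemma avg_ineq (hmom : ∀ t i, Integrable id (μ t i)) (hπ : π ∈ VMT N d μ) {f h} (a : Adm N d μ f h)
    (hp : ∀ x, 0 ≤ payR N d f h x) (i : Fin d) (z : ℕ → ℝ) :
    0 ≤ ∑ t : Fin N, (f t i (z t) + Hav π h i t z * (z ((t : ℕ) + 1) - z t)) +
      (cost μ f - ∑ t, ∫ y, f t i y ∂(μ t i)) := by
  have := hπ.1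
  obtain ⟨M, hM⟩ := a.b2
  set T : Fin N → Fin d → (Fin N → Fin d → ℝ) → ℝ := fun t j x => f t j (subst i z x t j) +
      (if ht : (t : ℕ) + 1 < N then
          h ((t : ℕ) + 1) j (fun s => subst i z x ⟨s.val, by have := s.isLt; have := t.isLt; omega⟩) *
            (subst i z x ⟨(t : ℕ) + 1, ht⟩ j - subst i z x t j)
        else 0) with hT
  have key : ∀ t j, Integrable (T t j) π ∧ ∫ x, T t j x ∂π = if j = i then
      f t i (z t) + Hav π h i t z * (z ((t : ℕ) + 1) - z t) else ∫ y, f t j y ∂(μ t j) := by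
    intro t j
    by_cases hj : j = i
    · subst hj
      simp only [hT, Hav, if_true]
      by_cases ht : (t : ℕ) + 1 < N
      · simp only [ht, dif_pos]
        have hi : Integrable (fun x : Fin N → Fin d → ℝ => h ((t : ℕ) + 1) j
          (subst j z (fun s : Fin ((t : ℕ) + 1) => x ⟨s.val, by have := s.isLt; omega⟩))) π :=
          Integrable.of_bound (C := M) (((a.c2 _ _).measurable.comp (subst_meas j z)).comp
            (meas_restr _)).aestronglyMeasurable (Eventually.of_forall fun x => hM _ _ _)
        have h2 : ∀ x : Fin N → Fin d → ℝ, f t j (subst j z x t j) +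
            h ((t : ℕ) + 1) j (fun s => subst j z x ⟨s.val, by have := s.isLt; have := t.isLt; omega⟩) *
            (subst j z x ⟨(t : ℕ) + 1, ht⟩ j - subst j z x t j) = f t j (z t) + h ((t : ℕ) + 1) j
          (subst j z (fun s : Fin ((t : ℕ) + 1) => x ⟨s.val, by have := s.isLt; omega⟩)) * (z ((t : ℕ) + 1) - z t) := by
          intro x
          have e1 : subst j z x t j = z t := by simp [subst]
          have e2 : subst j z x ⟨(t : ℕ) + 1, ht⟩ j = z ((t : ℕ) + 1) := by simp [subst]
          rw [e1, e2]; rfl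
        simp only [h2]
        refine ⟨(integrable_const _).add (hi.mul_const _), ?_⟩
        rw [integral_add (integrable_const _) (hi.mul_const _), integral_mul_const]
        simp
      · simp only [ht, dif_neg, not_false_eq_true]
        simp [subst]
    · simp only [hT, hj, if_false]
      have e0 : ∀ (x : Fin N → Fin d → ℝ) t, subst i z x t j = x t j := fun x t => by simp [subst, hj]
      simp only [e0]
      have h1 := vmt_integrable hπ t j (f t j) (a.c1 t j).measurable (a.i1 t j)
      have h2 := vmt_integral hπ t j (f t j) (a.c1 t j).measurable
      by_cases ht : (t : ℕ) + 1 < N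
      · simp only [ht, dif_pos]
        have h3 := vmt_mart hmom hπ t ht j (fun y => h ((t:ℕ)+1) j (subst i z y))
          ((a.c2 _ _).measurable.comp (subst_meas i z)) M (fun y => hM _ _ _)
        refine ⟨h1.add h3.1, ?_⟩
        refine (integral_add h1 h3.1).trans ?_
        have h4 := h3.2
        rw [h4, h2, add_zero]
      · simp only [ht, dif_neg, not_false_eq_true, add_zero]
        exact ⟨h1, h2⟩
  have h1 : 0 ≤ ∫ x, ∑ t, ∑ j, T t j x ∂π := integral_nonneg fun x => hp (subst i z x)
  rw [integral_finsetSum _ fun t _ => integrable_finsetSum _ fun j _ => (key t j).1] at h1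
  have h2 : ∀ t, ∫ x, ∑ j, T t j x ∂π = (f t i (z t) + Hav π h i t z * (z ((t : ℕ) + 1) - z t)) +
      (∑ j, ∫ y, f t j y ∂(μ t j) - ∫ y, f t i y ∂(μ t i)) := by
    intro t
    rw [integral_finsetSum _ fun j _ => (key t j).1]
    simp only [(key t _).2]
    rw [← Finset.add_sum_erase _ _ (Finset.mem_univ i), ← Finset.add_sum_erase _ (fun j => ∫ y, f t j y ∂(μ t j)) (Finset.mem_univ i)]
    rw [if_pos rfl]
    have : ∑ j ∈ Finset.univ.erase i, (if j = i then f t i (z t) + Hav π h i t z * (z ((t : ℕ) + 1) - z t) else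
        ∫ y, f t j y ∂(μ t j)) = ∑ j ∈ Finset.univ.erase i, ∫ y, f t j y ∂(μ t j) :=
      Finset.sum_congr rfl fun j hj => if_neg (Finset.ne_of_mem_erase hj)
    rw [this]; ring
  simp only [h2, Finset.sum_add_distrib, Finset.sum_sub_distrib] at h1
  simp only [cost, Finset.sum_add_distrib]
  linarith

end


/-- dual data -/
structure Elt (N d : ℕ) where
  φ : Fin N → Fin d → ℝ → ℝ
  h : (t : ℕ) → Fin d → (Fin t → Fin d → ℝ) → ℝ
  χ : ℕ → Fin d → ℝ → ℝ
  q : ℕ → Fin d → ℝ → ℝ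

/-- midpoint -/
def Elt.mid {N d : ℕ} (e e' : Elt N d) : Elt N d where
  φ := (1/2 : ℝ) • e.φ + (1/2 : ℝ) • e'.φ
  h := (1/2 : ℝ) • e.h + (1/2 : ℝ) • e'.h
  χ := (1/2 : ℝ) • e.χ + (1/2 : ℝ) • e'.χ
  q := (1/2 : ℝ) • e.q + (1/2 : ℝ) • e'.q

/-- normalised dual data -/
structure Good {N d : ℕ} (μ : Fin N → Fin d → Measure ℝ) (v : Fin N → Fin d → ℝ → ℝ)
    (c : (Fin N → Fin d → ℝ) → ℝ) (a : ℕ → Fin d → ℝ) (K C : ℝ) (e : Elt N d) : Prop where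
  mφ : ∀ t i, Measurable (e.φ t i)
  iφ : ∀ t i, Integrable (e.φ t i) (μ t i)
  mh : ∀ t i, Measurable (e.h t i)
  bh : ∃ M, ∀ t i y, |e.h t i y| ≤ M
  hedge : ∀ x, c x ≤ payR N d e.φ e.h x
  hcost : cost μ e.φ ≤ C
  bq : ∃ M, ∀ s i x, |e.q s i x| ≤ M
  sub : ∀ s i x y, e.χ s i x + e.q s i x * (y - x) ≤ e.χ s i y
  χa : ∀ s i, e.χ s i (a s i) = 0
  qa : ∀ s i, e.q s i (a s i) = 0
  z0 : ∀ i, e.χ 0 i = 0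
  zN : ∀ i, e.χ N i = 0
  g0 : ∀ t i x, 0 ≤ e.φ t i x + v t i x + K - e.χ t i x + e.χ ((t : ℕ) + 1) i x

section
variable {N d : ℕ} {μ : Fin N → Fin d → Measure ℝ} {v : Fin N → Fin d → ℝ → ℝ}
    {c : (Fin N → Fin d → ℝ) → ℝ} {a : ℕ → Fin d → ℝ} {K C : ℝ}

lemma Good.mid {e e' : Elt N d} (g : Good μ v c a K C e) (g' : Good μ v c a K C e') :
    Good μ v c a K C (e.mid e') := by
  have hm : ∀ r s : ℝ, (1/2 : ℝ) • r + (1/2 : ℝ) • s = (r + s) / 2 := fun r s => by simp; ring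
  constructor
  · exact fun t i => ((g.mφ t i).const_smul (1/2 : ℝ)).add ((g'.mφ t i).const_smul (1/2 : ℝ))
  · exact fun t i => ((g.iφ t i).smul (1/2 : ℝ)).add ((g'.iφ t i).smul (1/2 : ℝ))
  · exact fun t i => ((g.mh t i).const_smul (1/2 : ℝ)).add ((g'.mh t i).const_smul (1/2 : ℝ))
  · obtain ⟨M, hM⟩ := g.bh
    obtain ⟨M', hM'⟩ := g'.bh
    refine ⟨M + M', fun t i y => ?_⟩
    simp only [Elt.mid, Pi.add_apply, Pi.smul_apply, hm]
    have h1 := hM t i y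
    have h2 := hM' t i y
    have h3 := abs_nonneg (e.h t i y)
    have h4 := abs_nonneg (e'.h t i y)
    rw [abs_div, abs_two]
    have := abs_add_le (e.h t i y) (e'.h t i y)
    linarith
  · intro x
    simp only [Elt.mid]
    rw [payR_add, payR_smul, payR_smul]
    have := g.hedge x
    have := g'.hedge x
    linarith
  · simp only [Elt.mid]
    rw [cost_add (φ := (1/2 : ℝ) • e.φ) (φ' := (1/2 : ℝ) • e'.φ) (fun t i => (g.iφ t i).smul (1/2 : ℝ)) (fun t i => (g'.iφ t i).smul (1/2 : ℝ)), cost_smul, cost_smul]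
    have := g.hcost
    have := g'.hcost
    linarith
  · obtain ⟨M, hM⟩ := g.bq
    obtain ⟨M', hM'⟩ := g'.bq
    refine ⟨M + M', fun t i y => ?_⟩
    simp only [Elt.mid, Pi.add_apply, Pi.smul_apply, hm]
    have h1 := hM t i y
    have h2 := hM' t i y
    have h3 := abs_nonneg (e.q t i y)
    have h4 := abs_nonneg (e'.q t i y)
    rw [abs_div, abs_two]
    have := abs_add_le (e.q t i y) (e'.q t i y)
    linarith
  · intro s i x y
    simp only [Elt.mid, Pi.add_apply, Pi.smul_apply, hm]
    have := g.sub s i x y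
    have := g'.sub s i x y
    linarith
  · intro s i
    simp [Elt.mid, g.χa, g'.χa]
  · intro s i
    simp [Elt.mid, g.qa, g'.qa]
  · intro i; simp [Elt.mid, g.z0, g'.z0]
  · intro i; simp [Elt.mid, g.zN, g'.zN]
  · intro t i x
    simp only [Elt.mid, Pi.add_apply, Pi.smul_apply, hm]
    have := g.g0 t i x
    have := g'.g0 t i x
    linarith

lemma Good.mono {e : Elt N d} {C' : ℝ} (g : Good μ v c a K C e) (h : C ≤ C') : Good μ v c a K C' e :=
  { g with hcost := g.hcost.trans h }

lemma good_exists {π : Measure (Fin N → Fin d → ℝ)} (hN : 0 < N) (hd : 0 < d)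
    (hprob : ∀ t i, IsProbabilityMeasure (μ t i))
    (hmom : ∀ t i, Integrable id (μ t i)) (hπ : π ∈ VMT N d μ)
    (hv : ∀ t i, Continuous (v t i) ∧ Integrable (v t i) (μ t i))
    (hcbound : ∀ x, |c x| ≤ ∑ t : Fin N, ∑ i : Fin d, v t i (x t i))
    {φ h} (ha : Adm N d μ φ h) (hp : ∀ x, c x ≤ payR N d φ h x) (hC : cost μ φ ≤ C)
    (hK : C + cost μ v ≤ K) (a : ℕ → Fin d → ℝ) : ∃ e : Elt N d, Good μ v c a K C e := by
  have hadv : Adm N d μ v 0 := ⟨fun t i => (hv t i).1, fun t i => (hv t i).2, fun t i => continuous_const,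
    ⟨0, fun t i y => by simp⟩⟩
  have haf := ha.add hadv
  obtain ⟨M, hM⟩ := ha.b2
  have hpf : ∀ x, 0 ≤ payR N d (φ + v) (h + 0) x := by
    intro x
    rw [payR_add, payR_zero_h]
    have h1 := hp x
    have h2 := (abs_le.1 (hcbound x)).1
    linarith
  set A : ℝ := cost μ (φ + v) with hA
  have hA0 : 0 ≤ A := cost_nonneg_of hmom hπ haf hpf
  have hAK : A ≤ K := by
    rw [hA, cost_add ha.i1 hadv.i1]; linarith
  set Ai : Fin d → ℝ := fun i => ∑ t, ∫ y, (φ + v) t i y ∂(μ t i) with hAi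
  have hAsum : ∑ i, Ai i = A := by
    rw [hA, cost, hAi]; exact Finset.sum_comm
  set sh : Fin d → ℝ := fun i => (A / d - Ai i) / N with hsh
  have hNr : (N : ℝ) ≠ 0 := by positivity
  have hdr : (d : ℝ) ≠ 0 := by positivity
  have hshsum : ∑ _t : Fin N, ∑ i, sh i = 0 := by
    have : ∑ i, sh i = 0 := by
      simp only [hsh]
      rw [← Finset.sum_div, Finset.sum_sub_distrib, hAsum]
      simp only [Finset.sum_const, Finset.card_univ, Fintype.card_fin, nsmul_eq_mul]
      field_simp; simp
    simp [this]
  have hconv : ∀ i, ∃ χ q : ℕ → ℝ → ℝ, (χ 0 = 0) ∧ (q 0 = 0) ∧ (∀ s, N - 1 < s → χ s = 0 ∧ q s = 0) ∧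
      (∀ s x y, χ s x + q s x * (y - x) ≤ χ s y) ∧ (∀ s x, |q s x| ≤ M) ∧
      ∀ t ≤ N - 1, ∀ x, χ t x ≤ (if ht : t < N then φ ⟨t, ht⟩ i x + v ⟨t, ht⟩ i x + sh i + K else 0) + χ (t + 1) x := by
    intro i
    have hM0 : 0 ≤ M := (abs_nonneg _).trans (hM 0 i 0)
    have hpr := hπ.1
    refine conv1 M (N - 1) (fun t x => if ht : t < N then φ ⟨t, ht⟩ i x + v ⟨t, ht⟩ i x + sh i + K else 0)
      (Hav π (h + 0) i) ?_ ?_ ?_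
    · intro t z z' hz
      unfold Hav
      by_cases ht : t + 1 < N
      · simp only [ht, dif_pos]
        refine integral_congr_ae (Eventually.of_forall fun x => ?_)
        refine congrArg _ (funext fun s => funext fun j => ?_)
        unfold subst
        rw [hz s (by have := s.isLt; omega)]
      · simp only [ht, dif_neg, not_false_eq_true]
    · intro t z
      unfold Hav
      by_cases ht : t + 1 < N
      · simp only [ht, dif_pos]
        have := norm_integral_le_of_norm_le_const (μ := π) (C := M) (f := fun x : Fin N → Fin d → ℝ => (h + 0) (t + 1) i (subst i z (fun s : Fin (t + 1) => x ⟨s.val, by have := s.isLt; omega⟩))) (Eventually.of_forall fun x => by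
          rw [Real.norm_eq_abs, add_zero]; exact hM _ _ _)
        simpa using this
      · simp only [ht, dif_neg, not_false_eq_true, abs_zero, hM0]
    · intro z
      have h1 := avg_ineq hmom hπ haf hpf i z
      have e1 : N - 1 + 1 = N := by omega
      rw [e1, Finset.sum_range]
      have e2 : ∑ t ∈ Finset.range (N - 1), Hav π (h + 0) i t z * (z (t + 1) - z t) =
          ∑ t : Fin N, Hav π (h + 0) i t z * (z ((t : ℕ) + 1) - z t) := by
        rw [Fin.sum_univ_eq_sum_range (fun t => Hav π (h + 0) i t z * (z (t + 1) - z t)), show Finset.range N = Finset.range (N - 1 + 1) by rw [e1], Finset.sum_range_succ]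
        have : Hav π (h + 0) i (N - 1) z = 0 := by
          unfold Hav; rw [dif_neg (by omega)]
        rw [this]; simp
      rw [e2]
      simp only [Fin.is_lt, dif_pos, Fin.eta]
      simp only [Finset.sum_add_distrib, Pi.add_apply] at h1 ⊢
      simp only [Finset.sum_const, Finset.card_univ, Fintype.card_fin, nsmul_eq_mul]
      have e3 : (N : ℝ) * sh i = A / d - Ai i := by simp only [hsh]; field_simp
      have e4 : A ≤ N * K := by
        have : (1:ℝ) ≤ N := by exact_mod_cast hN
        nlinarith
      have e5 : 0 ≤ A / d := by positivity
      rw [e3]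
      simp only [hA, hAi] at *
      simp only [Pi.add_apply] at *
      linarith
  choose χ q hχ0 hq0 hχN hsub hqM hg using hconv
  set l : ℕ → Fin d → ℝ → ℝ := fun s i x => χ i s (a s i) + q i s (a s i) * (x - a s i) with hl
  have hl0 : ∀ i, l 0 i = 0 := fun i => by ext x; simp [hl, hχ0, hq0]
  have hlN : ∀ i, l N i = 0 := fun i => by ext x; simp [hl, hχN i N (by omega)]
  have hli : ∀ s t i, Integrable (l s i) (μ t i) := fun s t i =>
    (integrable_const _).add (((hmom t i).sub (integrable_const _)).const_mul _)
  have hlm : ∀ s i, Measurable (l s i) := fun s i => by simp only [hl]; fun_prop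
  set φ' : Fin N → Fin d → ℝ → ℝ := fun t i x => φ t i x + sh i - l t i x + l ((t : ℕ) + 1) i x with hφ'
  set h' : (t : ℕ) → Fin d → (Fin t → Fin d → ℝ) → ℝ := fun t i y => h t i y + q i t (a t i) with hh'
  have hpay : ∀ x, payR N d φ' h' x = payR N d φ h x := by
    intro x
    have e1 : ∀ t : Fin N, ∀ i : Fin d, (φ' t i (x t i) +
      (if ht : (t : ℕ) + 1 < N then
          h' ((t : ℕ) + 1) i (fun s => x ⟨s.val, by have := s.isLt; have := t.isLt; omega⟩) *
            (x ⟨(t : ℕ) + 1, ht⟩ i - x t i)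
        else 0)) = (φ t i (x t i) +
      (if ht : (t : ℕ) + 1 < N then
          h ((t : ℕ) + 1) i (fun s => x ⟨s.val, by have := s.isLt; have := t.isLt; omega⟩) *
            (x ⟨(t : ℕ) + 1, ht⟩ i - x t i)
        else 0)) + sh i + (- l t i (x t i) + l ((t : ℕ) + 1) i (x t i) +
      (if h : (t : ℕ) + 1 < N then l ((t : ℕ) + 1) i (x ⟨(t : ℕ) + 1, h⟩ i) - l ((t : ℕ) + 1) i (x t i) else 0)) := by
      intro t i
      by_cases ht : (t : ℕ) + 1 < N
      · simp only [ht, dif_pos, hφ', hh', hl]; ring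
      · simp only [ht, dif_neg, not_false_eq_true, hφ']; ring
    unfold payR
    simp only [e1]
    simp only [Finset.sum_add_distrib (f := fun i => _ + sh i), Finset.sum_add_distrib (g := fun i => sh i)]
    have e2 : ∑ t : Fin N, ∑ i : Fin d, (- l t i (x t i) + l ((t : ℕ) + 1) i (x t i) +
      (if h : (t : ℕ) + 1 < N then l ((t : ℕ) + 1) i (x ⟨(t : ℕ) + 1, h⟩ i) - l ((t : ℕ) + 1) i (x t i) else 0)) = 0 := by
      rw [Finset.sum_comm]
      exact Finset.sum_eq_zero fun i _ => tele (fun s => l s i) (hl0 i) (hlN i) (fun t => x t i)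
    rw [Finset.sum_add_distrib, e2, Finset.sum_add_distrib, hshsum]; ring
  have iφ' : ∀ t i, Integrable (φ' t i) (μ t i) := fun t i =>
    (((ha.i1 t i).add (integrable_const _)).sub (hli _ _ _)).add (hli _ _ _)
  have mφ' : ∀ t i, Measurable (φ' t i) := fun t i =>
    ((((ha.c1 t i).measurable.add measurable_const).sub (hlm _ _))).add (hlm _ _)
  have mh' : ∀ t i, Measurable (h' t i) := fun t i => (ha.c2 t i).measurable.add measurable_const
  have bh' : ∀ t i y, |h' t i y| ≤ M + M := fun t i y =>
    (abs_add_le _ _).trans (add_le_add (hM t i y) (hqM i t _))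
  refine ⟨⟨φ', h', fun s i x => χ i s x - l s i x, fun s i x => q i s x - q i s (a s i)⟩, ⟨mφ', iφ', mh', ⟨_, bh'⟩, ?_, ?_,
    ⟨M + M, fun s i x => ?_⟩, ?_, ?_, ?_, ?_, ?_, ?_⟩⟩
  · intro x; rw [hpay]; exact hp x
  · have h1 := (vmt_pay hmom hπ φ' h' mφ' iφ' mh' _ bh').2
    simp only [hpay] at h1
    rw [(pay_cost hmom hπ ha).2] at h1
    have : cost μ φ' = cost μ φ := h1.symm
    dsimp only
    rw [this]; exact hC
  · exact (abs_sub _ _).trans (add_le_add (hqM _ _ _) (hqM _ _ _))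
  · intro s i x y
    have := hsub i s x y
    simp only [hl]
    linarith
  · intro s i; simp [hl]
  · intro s i; simp
  · intro i; ext x; simp [hl0, hχ0]
  · intro i; ext x; simp [hlN, hχN i N (by omega)]
  · intro t i x
    have := hg i t (by have := t.isLt; omega) x
    rw [dif_pos t.isLt] at this
    simp only [hφ'] at *
    simp only [Fin.eta] at this
    linarith

end


lemma pot_meas (μ : Measure ℝ) [IsProbabilityMeasure μ] : Measurable (potentialFn μ) := by
  unfold potentialFn
  refine (StronglyMeasurable.integral_prod_right (f := fun x y : ℝ => |x - y|) ?_).measurable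
  exact (measurable_fst.sub measurable_snd).abs.stronglyMeasurable

lemma subgrad_mono {χ q : ℝ → ℝ} (h : ∀ x y, χ x + q x * (y - x) ≤ χ y) : Monotone q := by
  intro x y hxy
  rcases hxy.eq_or_lt with rfl | hlt
  · rfl
  · have h1 := h x y
    have h2 := h y x
    by_contra hc
    push Not at hc
    nlinarith

/-- gap bounded along the sequence -/
def GB (χ q : ℕ → ℝ → ℝ) (x y : ℝ) : Prop := ∃ C, ∀ n, χ n y - χ n x - q n x * (y - x) ≤ C

lemma GB_rel {χ q : ℕ → ℝ → ℝ} (hs : ∀ n x y, χ n x + q n x * (y - x) ≤ χ n y) {x y z : ℝ} (h : GB χ q x y)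
    (hz : (x ≤ z ∧ z < y) ∨ (y < z ∧ z ≤ x)) : ∃ C, ∀ n, |q n z - q n x| ≤ C := by
  obtain ⟨C, hC⟩ := h
  refine ⟨C / |y - z|, fun n => ?_⟩
  have hpos : 0 < |y - z| := abs_pos.2 (sub_ne_zero.2 (by rcases hz with h | h <;> [exact h.2.ne'; exact h.1.ne]))
  rw [le_div_iff₀ hpos, ← abs_mul]
  have h1 := hs n z y
  have h2 := hs n x z
  have h3 := hC n
  have hm := subgrad_mono (hs n)
  have h4 : 0 ≤ (q n z - q n x) * (y - z) := by
    rcases hz with h | h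
    · exact mul_nonneg (sub_nonneg.2 (hm h.1)) (by linarith [h.2])
    · exact mul_nonneg_of_nonpos_of_nonpos (sub_nonpos.2 (hm h.2)) (by linarith [h.1])
  rw [abs_of_nonneg h4]
  nlinarith

lemma bdd_on_interval {χ q : ℕ → ℝ → ℝ} (hs : ∀ n x y, χ n x + q n x * (y - x) ≤ χ n y) {I : Set ℝ}
    (hI : IsPreconnected I) {a : ℝ} (ha : a ∈ I) (hχa : ∀ n, χ n a = 0) (hqa : ∀ n, q n a = 0)
    (hb : ∀ b ∈ I, (∃ x y, GB χ q x y ∧ ((x < b ∧ b < y) ∨ (y < b ∧ b < x))) ∨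
      ((∃ y, b < y ∧ GB χ q b y) ∧ (∃ y, y < b ∧ GB χ q b y))) {z : ℝ} (hz : z ∈ I) :
    ∃ C, ∀ n, |q n z| ≤ C ∧ 0 ≤ χ n z ∧ χ n z ≤ C := by
  have hrel : ∃ C, ∀ n, |q n z - q n a| ≤ C := by
    refine hI.induction₂ (fun z z' => ∃ C, ∀ n, |q n z - q n z'| ≤ C) ?_ ?_ ?_ hz ha
    · intro b hbI
      refine Filter.Eventually.filter_mono nhdsWithin_le_nhds ?_
      rcases hb b hbI with ⟨x, y, hg, h⟩ | ⟨⟨y, hy, hg⟩, ⟨y', hy', hg'⟩⟩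
      · have key : ∀ z, ((x < z ∧ z < y) ∨ (y < z ∧ z < x)) → ∃ C, ∀ n, |q n z - q n x| ≤ C := fun z hz =>
          GB_rel hs hg (by rcases hz with h | h; exacts [Or.inl ⟨h.1.le, h.2⟩, Or.inr ⟨h.1, h.2.le⟩])
        have key2 : ∀ z, ((x < z ∧ z < y) ∨ (y < z ∧ z < x)) → ∃ C, ∀ n, |q n b - q n z| ≤ C := by
          intro z hz
          obtain ⟨C1, h1⟩ := key b h
          obtain ⟨C2, h2⟩ := key z hz
          refine ⟨C1 + C2, fun n => ?_⟩
          have e : q n b - q n z = (q n b - q n x) - (q n z - q n x) := by ring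
          rw [e]
          exact (abs_sub _ _).trans (add_le_add (h1 n) (h2 n))
        rcases h with h | h
        · filter_upwards [Ioo_mem_nhds h.1 h.2] with z hz using key2 z (Or.inl hz)
        · filter_upwards [Ioo_mem_nhds h.1 h.2] with z hz using key2 z (Or.inr hz)
      · filter_upwards [Ioo_mem_nhds hy' hy] with z hz
        simp only [abs_sub_comm (q _ b)]
        rcases le_total b z with h | h
        · exact GB_rel hs hg (Or.inl ⟨h, hz.2⟩)
        · exact GB_rel hs hg' (Or.inr ⟨hz.1, h⟩)
    · rintro x y z - - - ⟨C1, h1⟩ ⟨C2, h2⟩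
      exact ⟨C1 + C2, fun n => (abs_sub_le _ (q n y) _).trans (add_le_add (h1 n) (h2 n))⟩
    · rintro x y - - ⟨C, h⟩
      exact ⟨C, fun n => by rw [abs_sub_comm]; exact h n⟩
  obtain ⟨C, hC⟩ := hrel
  have hC' : ∀ n, |q n z| ≤ C := fun n => by simpa [hqa] using hC n
  have hC0 : 0 ≤ C := (abs_nonneg _).trans (hC' 0)
  refine ⟨C + C * |z - a|, fun n => ⟨?_, ?_, ?_⟩⟩
  · have := hC' n; have := mul_nonneg hC0 (abs_nonneg (z - a)); linarith
  · have := hs n a z; rw [hχa, hqa] at this; linarith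
  · have h1 := hs n z a
    rw [hχa] at h1
    have h2 : q n z * (z - a) ≤ C * |z - a| := (le_abs_self _).trans (by
      rw [abs_mul]; exact mul_le_mul_of_nonneg_right (hC' n) (abs_nonneg _))
    linarith

section
variable {N d : ℕ} {μ : Fin N → Fin d → Measure ℝ} {π : Measure (Fin N → Fin d → ℝ)}

lemma irr_pts (hmom : ∀ t i, Integrable id (μ t i)) (hπ : π ∈ VMT N d μ) (t : ℕ) (ht : t + 1 < N) (i : Fin d)
    (Γ : (Fin N → Fin d → ℝ) → Prop) (hΓ : ∀ᵐ x ∂π, Γ x) (b : ℝ)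
    (hb : potentialFn (μ ⟨t, by omega⟩ i) b < potentialFn (μ ⟨t + 1, ht⟩ i) b) :
    (∃ x, Γ x ∧ ((x ⟨t, by omega⟩ i < b ∧ b < x ⟨t + 1, ht⟩ i) ∨ (x ⟨t + 1, ht⟩ i < b ∧ b < x ⟨t, by omega⟩ i))) ∨
    ((∃ x, Γ x ∧ x ⟨t, by omega⟩ i = b ∧ b < x ⟨t + 1, ht⟩ i) ∧
     (∃ x, Γ x ∧ x ⟨t, by omega⟩ i = b ∧ x ⟨t + 1, ht⟩ i < b)) := by
  have hpr := hπ.1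
  by_contra hcon
  rw [not_or, not_and_or] at hcon
  obtain ⟨hc1, hc2⟩ := hcon
  push Not at hc1
  have main : ∀ s : ℝ → ℝ, Measurable s → (∀ x, |s x| ≤ 1) → (∀ x : Fin N → Fin d → ℝ, Γ x →
      |b - x ⟨t + 1, ht⟩ i| - |b - x ⟨t, by omega⟩ i| = s (x ⟨t, by omega⟩ i) * (x ⟨t + 1, ht⟩ i - x ⟨t, by omega⟩ i)) → False := by
    intro s hs hs1 he
    have h1 := vmt_mart hmom hπ t ht i (fun y => s (y ⟨t, by omega⟩ i)) (hs.comp (meas_ev _ _)) 1 (fun y => hs1 _)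
    have hm : Measurable fun y : ℝ => |b - y| := (measurable_const.sub measurable_id).abs
    have hi : ∀ r, Integrable (fun y : ℝ => |b - y|) (μ r i) := fun r => by
      have : IsProbabilityMeasure (μ r i) := by
        rw [← hπ.2.1 r i]; exact Measure.isProbabilityMeasure_map (meas_ev r i).aemeasurable
      exact ((integrable_const b).sub (hmom r i)).abs
    have h2 : ∫ x : Fin N → Fin d → ℝ, (|b - x ⟨t + 1, ht⟩ i| - |b - x ⟨t, by omega⟩ i|) ∂π = 0 := by
      rw [← h1.2]
      refine integral_congr_ae ?_
      filter_upwards [hΓ] with x hx using he x hx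
    rw [integral_sub (vmt_integrable hπ ⟨t + 1, ht⟩ i _ hm (hi _)) (vmt_integrable hπ ⟨t, by omega⟩ i _ hm (hi _)),
      vmt_integral hπ ⟨t + 1, ht⟩ i _ hm, vmt_integral hπ ⟨t, by omega⟩ i _ hm] at h2
    unfold potentialFn at hb
    linarith
  rcases hc2 with hc2 | hc2
  · push Not at hc2
    refine main (fun x => if x ≤ b then -1 else 1) (Measurable.ite measurableSet_Iic measurable_const measurable_const)
      (fun x => by split_ifs <;> simp) fun x hx => ?_
    have h1 := hc1 x hx
    have h2 := hc2 x hx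
    split_ifs with h
    · have h3 : x ⟨t + 1, ht⟩ i ≤ b := by
        rcases h.lt_or_eq with h | h
        exacts [h1.1 h, h2 h]
      rw [abs_of_nonneg (by linarith), abs_of_nonneg (by linarith)]; ring
    · push Not at h
      have h3 : b ≤ x ⟨t + 1, ht⟩ i := by
        by_contra h4; push Not at h4; have := h1.2 h4; linarith
      rw [abs_of_nonpos (by linarith), abs_of_nonpos (by linarith)]; ring
  · push Not at hc2
    refine main (fun x => if x < b then -1 else 1) (Measurable.ite measurableSet_Iio measurable_const measurable_const)
      (fun x => by split_ifs <;> simp) fun x hx => ?_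
    have h1 := hc1 x hx
    have h2 := hc2 x hx
    split_ifs with h
    · have h3 : x ⟨t + 1, ht⟩ i ≤ b := h1.1 h
      rw [abs_of_nonneg (by linarith), abs_of_nonneg (by linarith)]; ring
    · push Not at h
      have h3 : b ≤ x ⟨t + 1, ht⟩ i := by
        rcases h.lt_or_eq with h | h
        · by_contra h4; push Not at h4; have := h1.2 h4; linarith
        · exact h2 h.symm
      rw [abs_of_nonpos (by linarith), abs_of_nonpos (by linarith)]; ring

lemma mean_eq (hmom : ∀ t i, Integrable id (μ t i)) (hπ : π ∈ VMT N d μ) (t : ℕ) (ht : t + 1 < N) (i : Fin d) :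
    ∫ y, y ∂(μ ⟨t, by omega⟩ i) = ∫ y, y ∂(μ ⟨t + 1, ht⟩ i) := by
  have h1 := (vmt_mart hmom hπ t ht i (fun _ => 1) measurable_const 1 (by simp)).2
  simp only [one_mul] at h1
  have h2 := integral_sub (vmt_integrable hπ ⟨t + 1, ht⟩ i _ measurable_id (hmom _ _))
    (vmt_integrable hπ ⟨t, by omega⟩ i _ measurable_id (hmom _ _))
  rw [vmt_integral hπ ⟨t + 1, ht⟩ i _ measurable_id, vmt_integral hπ ⟨t, by omega⟩ i _ measurable_id] at h2
  simp only [id] at h2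
  linarith

end

lemma both_sides {μ ν : Measure ℝ} [IsProbabilityMeasure μ] [IsProbabilityMeasure ν] (h1 : Integrable id μ)
    (h2 : Integrable id ν) (hm : ∫ y, y ∂μ = ∫ y, y ∂ν) {x : ℝ} (hx : potentialFn μ x < potentialFn ν x)
    {S : Set ℝ} (hS : ∀ᵐ y ∂ν, y ∈ S) : (∃ y ∈ S, x < y) ∧ (∃ y ∈ S, y < x) := by
  unfold potentialFn at hx
  have a1 : |∫ y, (x - y) ∂μ| ≤ ∫ y, |x - y| ∂μ := abs_integral_le_integral_abs
  have e1 : ∫ y, (x - y) ∂μ = x - ∫ y, y ∂μ := by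
    refine (integral_sub (integrable_const x) h1).trans ?_; simp
  have e2 : ∫ y, (x - y) ∂ν = x - ∫ y, y ∂ν := by
    refine (integral_sub (integrable_const x) h2).trans ?_; simp
  rw [e1, hm, ← e2] at a1
  have b1 := neg_abs_le (∫ y, (x - y) ∂ν)
  have b2 := le_abs_self (∫ y, (x - y) ∂ν)
  constructor
  · by_contra hc
    push Not at hc
    have : ∫ y, |x - y| ∂ν = ∫ y, (x - y) ∂ν := by
      refine integral_congr_ae ?_
      filter_upwards [hS] with y hy
      have := hc y hy
      exact abs_of_nonneg (by linarith)
    linarith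
  · by_contra hc
    push Not at hc
    have : ∫ y, |x - y| ∂ν = ∫ y, -(x - y) ∂ν := by
      refine integral_congr_ae ?_
      filter_upwards [hS] with y hy
      have := hc y hy
      exact abs_of_nonpos (by linarith)
    rw [integral_neg] at this
    linarith


section
variable {X : Type*} [MeasurableSpace X]

lemma meas_sel {β : Type*} [MeasurableSpace β] (f : ℕ → X → β) (hf : ∀ n, Measurable (f n)) (σ : X → ℕ)
    (hσ : Measurable σ) : Measurable fun x => f (σ x) x := by
  have h : Measurable fun p : ℕ × X => f p.1 p.2 := measurable_from_prod_countable_right fun n => hf n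
  exact h.comp (hσ.prodMk measurable_id)

lemma sel_step (p : X → ℕ → Prop) (hp : ∀ n, MeasurableSet {x | p x n}) (m : X → ℕ) (hm : Measurable m) :
    ∃ n : X → ℕ, Measurable n ∧ (∀ x, m x < n x) ∧ ∀ x, (∃ j > m x, p x j) → p x (n x) := by
  classical
  have hp' : ∀ n, Measurable fun x => p x n := fun n => measurableSet_setOf.1 (hp n)
  have hlt : ∀ n : ℕ, Measurable fun x => m x < n := fun n => measurableSet_setOf.1 (measurableSet_lt hm measurable_const)
  set r : X → ℕ → Prop := fun x n => m x < n ∧ (p x n ∨ ¬ ∃ j, (m x < j ∧ p x j)) with hr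
  have hex : ∀ x, ∃ n, r x n := by
    intro x
    by_cases h : ∃ j, (m x < j ∧ p x j)
    · obtain ⟨j, h1, h2⟩ := h
      exact ⟨j, h1, Or.inl h2⟩
    · exact ⟨m x + 1, Nat.lt_succ_self _, Or.inr h⟩
  have hrm : ∀ n, MeasurableSet {x | r x n} := fun n => measurableSet_setOf.2
    ((hlt n).and ((hp' n).or (Measurable.exists fun j => (hlt j).and (hp' j)).not))
  refine ⟨fun x => Nat.find (hex x), measurable_find hex hrm, fun x => (Nat.find_spec (hex x)).1, ?_⟩
  rintro x ⟨j, h1, h2⟩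
  rcases (Nat.find_spec (hex x)).2 with h | h
  · exact h
  · exact absurd ⟨j, h1, h2⟩ h

lemma sel_scalar (u : ℕ → X → ℝ) (hu : ∀ n, Measurable (u n)) :
    ∃ (σ : ℕ → X → ℕ) (L : X → ℝ), (∀ k, Measurable (σ k)) ∧ Measurable L ∧
      (∀ x, StrictMono fun k => σ k x) ∧ ∀ x, (∃ C, ∀ n, |u n x| ≤ C) →
        Tendsto (fun k => u (σ k x) x) atTop (nhds (L x)) := by
  set L : X → ℝ := fun x => limsup (fun n => u n x) atTop with hL
  have hLm : Measurable L := Measurable.limsup hu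
  have hset : ∀ k n : ℕ, MeasurableSet {x | |u n x - L x| < 1 / ((k:ℝ) + 1)} := fun k n =>
    measurableSet_lt ((hu n).sub hLm).abs measurable_const
  choose nxt h1 h2 h3 using fun k : ℕ => sel_step (fun x n => |u n x - L x| < 1 / ((k:ℝ) + 1)) (hset k)
  let σ : ℕ → {m : X → ℕ // Measurable m} := fun k => Nat.rec ⟨fun _ => 0, measurable_const⟩
    (fun k m => ⟨nxt k m.1 m.2, h1 k m.1 m.2⟩) k
  have hσ : ∀ k x, (σ k).1 x < (σ (k+1)).1 x := fun k x => h2 k _ (σ k).2 x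
  refine ⟨fun k => (σ (k+1)).1, L, fun k => (σ (k+1)).2, hLm, fun x => strictMono_nat_of_lt_succ fun k => hσ (k+1) x, ?_⟩
  rintro x ⟨C, hC⟩
  have hbA : IsBoundedUnder (· ≤ ·) atTop (fun n => u n x) := ⟨C, by
    simp only [eventually_map]; exact Eventually.of_forall fun n => (abs_le.1 (hC n)).2⟩
  have hbB : IsBoundedUnder (· ≥ ·) atTop (fun n => u n x) := ⟨-C, by
    simp only [eventually_map]; exact Eventually.of_forall fun n => (abs_le.1 (hC n)).1⟩
  have hfreq : ∀ ε > 0, ∃ᶠ n in atTop, |u n x - L x| < ε := by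
    intro ε hε
    have f1 : ∃ᶠ n in atTop, L x - ε < u n x :=
      frequently_lt_of_lt_limsup hbB.isCoboundedUnder_le (by simp only [hL]; linarith)
    have f2 : ∀ᶠ n in atTop, u n x < L x + ε :=
      eventually_lt_of_limsup_lt (by simp only [hL]; linarith) hbA
    refine (f1.and_eventually f2).mono fun n hn => ?_
    rw [abs_lt]; constructor <;> linarith [hn.1, hn.2]
  have hclose : ∀ k, |u ((σ (k+1)).1 x) x - L x| < 1 / ((k:ℝ) + 1) := by
    intro k
    refine h3 k _ (σ k).2 x ?_
    obtain ⟨j, hj, hj'⟩ := (frequently_atTop.1 (hfreq (1 / ((k:ℝ) + 1)) (by positivity))) ((σ k).1 x + 1)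
    exact ⟨j, hj, hj'⟩
  rw [tendsto_iff_dist_tendsto_zero]
  refine squeeze_zero (fun _ => dist_nonneg) (fun k => ?_) (tendsto_one_div_add_atTop_nhds_zero_nat (𝕜 := ℝ))
  rw [Real.dist_eq]; exact (hclose k).le

lemma sel_vec {ι : Type*} [Fintype ι] (u : ℕ → ι → X → ℝ) (hu : ∀ n i, Measurable (u n i)) :
    ∃ (σ : ℕ → X → ℕ) (L : ι → X → ℝ), (∀ k, Measurable (σ k)) ∧ (∀ i, Measurable (L i)) ∧
      (∀ x, StrictMono fun k => σ k x) ∧ ∀ x, (∀ i, ∃ C, ∀ n, |u n i x| ≤ C) → ∀ i,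
        Tendsto (fun k => u (σ k x) i x) atTop (nhds (L i x)) := by
  classical
  have key : ∀ s : Finset ι, ∃ (σ : ℕ → X → ℕ) (L : ι → X → ℝ), (∀ k, Measurable (σ k)) ∧ (∀ i, Measurable (L i)) ∧
      (∀ x, StrictMono fun k => σ k x) ∧ ∀ x, (∀ i, ∃ C, ∀ n, |u n i x| ≤ C) → ∀ i ∈ s,
        Tendsto (fun k => u (σ k x) i x) atTop (nhds (L i x)) := by
    intro s
    induction s using Finset.induction_on with
    | empty => exact ⟨fun k _ => k, fun _ _ => 0, fun k => measurable_const, fun i => measurable_const,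
        fun x => strictMono_id, fun x _ i hi => by simp at hi⟩
    | insert i s his ih =>
      obtain ⟨σ, L, h1, h2, h3, h4⟩ := ih
      obtain ⟨σ', L', h1', h2', h3', h4'⟩ := sel_scalar (fun k x => u (σ k x) i x)
        (fun k => meas_sel (fun n => u n i) (fun n => hu n i) _ (h1 k))
      refine ⟨fun k x => σ (σ' k x) x, Function.update L i L', fun k => meas_sel σ h1 _ (h1' k), ?_,
        fun x => (h3 x).comp (h3' x), ?_⟩
      · intro j
        by_cases hj : j = i
        · subst hj; rw [Function.update_self]; exact h2'
        · rw [Function.update_of_ne hj]; exact h2 j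
      · intro x hx j hj
        by_cases hji : j = i
        · subst hji
          rw [Function.update_self]
          refine h4' x ?_
          obtain ⟨C, hC⟩ := hx j
          exact ⟨C, fun n => hC _⟩
        · rw [Function.update_of_ne hji]
          have := h4 x hx j (by simpa [hji] using hj)
          exact this.comp (h3' x).tendsto_atTop
  obtain ⟨σ, L, h1, h2, h3, h4⟩ := key Finset.univ
  exact ⟨σ, L, h1, h2, h3, fun x hx i => h4 x hx i (Finset.mem_univ i)⟩

end

/-- restriction of paths -/
def rs {d r s : ℕ} (hr : r ≤ s) (x : Fin s → Fin d → ℝ) : Fin r → Fin d → ℝ := fun j => x ⟨j.val, by have := j.isLt; omega⟩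

lemma rs_meas {d r s : ℕ} (hr : r ≤ s) : Measurable (rs (d := d) hr) := meas_restr _

lemma sel_nested {d : ℕ} (H : ℕ → (s : ℕ) → Fin d → (Fin s → Fin d → ℝ) → ℝ) (hH : ∀ n s i, Measurable (H n s i)) :
    ∃ (h : (s : ℕ) → Fin d → (Fin s → Fin d → ℝ) → ℝ) (τ : (s : ℕ) → ℕ → (Fin s → Fin d → ℝ) → ℕ),
      (∀ s i, Measurable (h s i)) ∧ (∀ s x, StrictMono fun k => τ s k x) ∧
      ∀ s (x : Fin s → Fin d → ℝ), (∀ r (hr : r ≤ s), 1 ≤ r → ∀ i, ∃ C, ∀ n, |H n r i (rs hr x)| ≤ C) →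
        ∀ r (hr : r ≤ s), 1 ≤ r → ∀ i, Tendsto (fun k => H (τ s k x) r i (rs hr x)) atTop (nhds (h r i (rs hr x))) := by
  have step : ∀ s (τ : ℕ → (Fin s → Fin d → ℝ) → ℕ), (∀ k, Measurable (τ k)) → (∀ x, StrictMono fun k => τ k x) →
      ∃ (τ' : ℕ → (Fin (s+1) → Fin d → ℝ) → ℕ) (L : Fin d → (Fin (s+1) → Fin d → ℝ) → ℝ),
        (∀ k, Measurable (τ' k)) ∧ (∀ x, StrictMono fun k => τ' k x) ∧ (∀ i, Measurable (L i)) ∧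
        (∀ x, ∃ ρ : ℕ → ℕ, StrictMono ρ ∧ ∀ k, τ' k x = τ (ρ k) (rs (Nat.le_succ s) x)) ∧
        ∀ x, (∀ i, ∃ C, ∀ n, |H n (s+1) i x| ≤ C) → ∀ i, Tendsto (fun k => H (τ' k x) (s+1) i x) atTop (nhds (L i x)) := by
    intro s τ h1 h2
    have hτm : ∀ k, Measurable fun x : Fin (s+1) → Fin d → ℝ => τ k (rs (Nat.le_succ s) x) := fun k =>
      (h1 k).comp (rs_meas _)
    obtain ⟨σ, L, a1, a2, a3, a4⟩ := sel_vec (X := Fin (s+1) → Fin d → ℝ)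
      (fun k i x => H (τ k (rs (Nat.le_succ s) x)) (s+1) i x)
      (fun k i => meas_sel (fun n => H n (s+1) i) (fun n => hH n _ i) _ (hτm k))
    refine ⟨fun k x => τ (σ k x) (rs (Nat.le_succ s) x), L,
      fun k => meas_sel (fun n x => τ n (rs (Nat.le_succ s) x)) hτm _ (a1 k),
      fun x => (h2 _).comp (a3 x), a2, fun x => ⟨fun k => σ k x, a3 x, fun k => rfl⟩, fun x hx i => a4 x (fun i => ?_) i⟩
    obtain ⟨C, hC⟩ := hx i
    exact ⟨C, fun n => hC _⟩
  choose T Lf b1 b2 b3 b4 b5 using step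
  let τ : (s : ℕ) → {τ : ℕ → (Fin s → Fin d → ℝ) → ℕ // (∀ k, Measurable (τ k)) ∧ (∀ x, StrictMono fun k => τ k x)} :=
    fun s => Nat.rec ⟨fun k _ => k, fun k => measurable_const, fun x => strictMono_id⟩
      (fun s t => ⟨T s t.1 t.2.1 t.2.2, b1 s t.1 t.2.1 t.2.2, b2 s t.1 t.2.1 t.2.2⟩) s
  let h : (s : ℕ) → Fin d → (Fin s → Fin d → ℝ) → ℝ := fun s => match s with
    | 0 => fun _ _ => 0
    | s + 1 => Lf s (τ s).1 (τ s).2.1 (τ s).2.2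
  refine ⟨h, fun s => (τ s).1, ?_, fun s => (τ s).2.2, ?_⟩
  · intro s i
    cases s with
    | zero => exact measurable_const
    | succ s => exact b3 s _ _ _ i
  · intro s
    induction s with
    | zero => intro x _ r hr h1; omega
    | succ s ih =>
      intro x hx r hr h1 i
      by_cases hrs : r = s + 1
      · subst hrs
        exact b5 s (τ s).1 (τ s).2.1 (τ s).2.2 x (fun i => hx (s+1) le_rfl h1 i) i
      · have hr' : r ≤ s := by omega
        obtain ⟨ρ, hρ, he⟩ := b4 s (τ s).1 (τ s).2.1 (τ s).2.2 x
        have := ih (rs (Nat.le_succ s) x) (fun r' hr'' h1' i => hx r' (by omega) h1' i) r hr' h1 i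
        refine (this.comp hρ.tendsto_atTop).congr fun k => ?_
        simp only [Function.comp]
        rw [← he k]
        rfl


section
variable {N d : ℕ} {μ : Fin N → Fin d → Measure ℝ} {v : Fin N → Fin d → ℝ → ℝ}
    {c : (Fin N → Fin d → ℝ) → ℝ} {a : ℕ → Fin d → ℝ} {K C : ℝ}

/-- the nonnegative static part -/
def fg (v : Fin N → Fin d → ℝ → ℝ) (K : ℝ) (e : Elt N d) (t : Fin N) (i : Fin d) (x : Fin N → Fin d → ℝ) : ℝ :=
  e.φ t i (x t i) + v t i (x t i) + K - e.χ t i (x t i) + e.χ ((t : ℕ) + 1) i (x t i)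

/-- the nonnegative convexity gap -/
def fG (e : Elt N d) (t : Fin N) (i : Fin d) (x : Fin N → Fin d → ℝ) : ℝ :=
  if ht : (t : ℕ) + 1 < N then
    e.χ ((t : ℕ) + 1) i (x ⟨(t : ℕ) + 1, ht⟩ i) - e.χ ((t : ℕ) + 1) i (x t i)
      - e.q ((t : ℕ) + 1) i (x t i) * (x ⟨(t : ℕ) + 1, ht⟩ i - x t i)
  else 0

/-- convex function at the earlier point -/
def f2 (e : Elt N d) (t : Fin N) (i : Fin d) (x : Fin N → Fin d → ℝ) : ℝ :=
  e.χ ((t : ℕ) + 1) i (x t i)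

/-- convex function at the later point -/
def f3 (e : Elt N d) (t : Fin N) (i : Fin d) (x : Fin N → Fin d → ℝ) : ℝ :=
  if ht : (t : ℕ) + 1 < N then e.χ ((t : ℕ) + 1) i (x ⟨(t : ℕ) + 1, ht⟩ i) else 0

lemma Good.χ0 {e : Elt N d} (g : Good μ v c a K C e) (s i x) : 0 ≤ e.χ s i x := by
  have := g.sub s i (a s i) x
  rw [g.χa, g.qa] at this; linarith

lemma Good.χm {e : Elt N d} (g : Good μ v c a K C e) (s i) : Measurable (e.χ s i) := by
  obtain ⟨M, hM⟩ := g.bq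
  exact (subgrad_reg (g.sub s i) (hM s i)).1.measurable

lemma Good.qm {e : Elt N d} (g : Good μ v c a K C e) (s i) : Measurable (e.q s i) := by
  obtain ⟨M, hM⟩ := g.bq
  exact (subgrad_reg (g.sub s i) (hM s i)).2.1

lemma Good.fgm {e : Elt N d} (hv : ∀ t i, Measurable (v t i)) (g : Good μ v c a K C e) (t i) : Measurable (fg v K e t i) := by
  unfold fg
  exact ((((g.mφ t i).comp (meas_ev t i)).add ((hv t i).comp (meas_ev t i))).add_const K |>.sub
    ((g.χm t i).comp (meas_ev t i))).add ((g.χm _ i).comp (meas_ev t i))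

lemma Good.fGm {e : Elt N d} (g : Good μ v c a K C e) (t i) : Measurable (fG e t i) := by
  unfold fG
  split_ifs with ht
  · exact (((g.χm _ i).comp (meas_ev _ i)).sub ((g.χm _ i).comp (meas_ev _ i))).sub
      (((g.qm _ i).comp (meas_ev _ i)).mul ((meas_ev _ i).sub (meas_ev _ i)))
  · exact measurable_const

lemma Good.f2m {e : Elt N d} (g : Good μ v c a K C e) (t i) : Measurable (f2 e t i) := by
  unfold f2
  exact (g.χm _ i).comp (meas_ev _ i)

lemma Good.f3m {e : Elt N d} (g : Good μ v c a K C e) (t i) : Measurable (f3 e t i) := by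
  unfold f3
  split_ifs with ht
  · exact (g.χm _ i).comp (meas_ev _ i)
  · exact measurable_const

lemma Good.fg0 {e : Elt N d} (g : Good μ v c a K C e) (t i x) : 0 ≤ fg v K e t i x := g.g0 t i _

lemma Good.fG0 {e : Elt N d} (g : Good μ v c a K C e) (t i x) : 0 ≤ fG e t i x := by
  unfold fG
  split_ifs with ht
  · have := g.sub ((t : ℕ) + 1) i (x t i) (x ⟨(t : ℕ) + 1, ht⟩ i); linarith
  · exact le_rfl

lemma Good.f30 {e : Elt N d} (g : Good μ v c a K C e) (t i x) : 0 ≤ f3 e t i x := by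
  unfold f3
  split_ifs with ht
  · exact g.χ0 _ _ _
  · exact le_rfl

/-- the total -/
lemma Good.total {e : Elt N d} (g : Good μ v c a K C e) (x : Fin N → Fin d → ℝ) :
    ∑ t, ∑ i, (fg v K e t i x + fG e t i x) =
      payR N d (fun t i y => e.φ t i y + v t i y + K)
        (fun s i y => if hs : 0 < s then - e.q s i (y ⟨s - 1, by omega⟩ i) else 0) x := by
  unfold payR
  have h1 : ∑ t : Fin N, ∑ i : Fin d, (- e.χ t i (x t i) + e.χ ((t : ℕ) + 1) i (x t i) +
      (if h : (t : ℕ) + 1 < N then e.χ ((t : ℕ) + 1) i (x ⟨(t : ℕ) + 1, h⟩ i) - e.χ ((t : ℕ) + 1) i (x t i) else 0)) = 0 := by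
    rw [Finset.sum_comm]
    refine Finset.sum_eq_zero fun i _ => ?_
    exact tele (fun s => e.χ s i) (g.z0 i) (g.zN i) (fun t => x t i)
  refine sub_eq_zero.1 (Eq.trans ?_ h1)
  refine sub_eq_zero.1 ?_
  simp only [← Finset.sum_sub_distrib]
  refine Finset.sum_eq_zero fun t _ => Finset.sum_eq_zero fun i _ => ?_
  unfold fg fG
  split_ifs with h2 h3
  · simp only [Nat.add_sub_cancel, Fin.eta]; ring
  · omega
  · ring

lemma Good.int_bounds {e : Elt N d} {π : Measure (Fin N → Fin d → ℝ)} (hprob : ∀ t i, IsProbabilityMeasure (μ t i))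
    (hmom : ∀ t i, Integrable id (μ t i)) (hπ : π ∈ VMT N d μ)
    (hv : ∀ t i, Measurable (v t i)) (hvi : ∀ t i, Integrable (v t i) (μ t i)) (g : Good μ v c a K C e) (t i) :
    (Integrable (fg v K e t i) π ∧ ∫ x, fg v K e t i x ∂π ≤ C + cost μ v + cost μ (fun _ _ _ => K)) ∧
    (Integrable (fG e t i) π ∧ ∫ x, fG e t i x ∂π ≤ C + cost μ v + cost μ (fun _ _ _ => K)) := by
  obtain ⟨M, hM⟩ := g.bq
  have hM0 : 0 ≤ M := (abs_nonneg _).trans (hM 0 i 0)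
  have hpay := vmt_pay hmom hπ (fun t i y => e.φ t i y + v t i y + K)
        (fun s i y => if hs : 0 < s then - e.q s i (y ⟨s - 1, by omega⟩ i) else 0)
        (fun t i => ((g.mφ t i).add (hv t i)).add_const K)
        (fun t i => ((g.iφ t i).add (hvi t i)).add (integrable_const K))
        (fun s i => by
          by_cases hs : 0 < s
          · simp only [hs, dif_pos]
            exact ((g.qm s i).comp (meas_ev _ i)).neg
          · simp only [hs]; exact measurable_const) M
        (fun s i y => by
          split_ifs with hs
          · rw [abs_neg]; exact hM _ _ _
          · simpa using hM0)
  have htot : ∫ x, payR N d (fun t i y => e.φ t i y + v t i y + K)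
        (fun s i y => if hs : 0 < s then - e.q s i (y ⟨s - 1, by omega⟩ i) else 0) x ∂π ≤ C + cost μ v + cost μ (fun _ _ _ => K) := by
    rw [hpay.2]
    have : cost μ ((e.φ + v) + fun _ _ _ => K) = cost μ e.φ + cost μ v + cost μ (fun _ _ _ => K) := by
      rw [cost_add (φ := e.φ + v) (fun t i => (g.iφ t i).add (hvi t i)) (fun t i => integrable_const K), cost_add g.iφ hvi]
    have h2 := g.hcost
    calc _ = cost μ ((e.φ + v) + fun _ _ _ => K) := rfl
      _ ≤ _ := by rw [this]; linarith
  have hle : ∀ x, fg v K e t i x + fG e t i x ≤ payR N d (fun t i y => e.φ t i y + v t i y + K)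
        (fun s i y => if hs : 0 < s then - e.q s i (y ⟨s - 1, by omega⟩ i) else 0) x := by
    intro x
    rw [← g.total x]
    have h0 : ∀ t i, 0 ≤ fg v K e t i x + fG e t i x := fun t i => add_nonneg (g.fg0 t i x) (g.fG0 t i x)
    refine le_trans ?_ (Finset.single_le_sum (f := fun t => ∑ i, (fg v K e t i x + fG e t i x)) (fun t _ => Finset.sum_nonneg fun i _ => h0 t i) (Finset.mem_univ t))
    exact Finset.single_le_sum (f := fun i => (fg v K e t i x + fG e t i x)) (fun i _ => h0 t i) (Finset.mem_univ i)
  have key : ∀ f : (Fin N → Fin d → ℝ) → ℝ, Measurable f → (∀ x, 0 ≤ f x) → (∀ x, f x ≤ fg v K e t i x + fG e t i x) →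
      Integrable f π ∧ ∫ x, f x ∂π ≤ C + cost μ v + cost μ (fun _ _ _ => K) := by
    intro f hf h0 hl
    have hi : Integrable f π := hpay.1.mono' hf.aestronglyMeasurable (Eventually.of_forall fun x => by
      rw [Real.norm_eq_abs, abs_of_nonneg (h0 x)]; exact (hl x).trans (hle x))
    exact ⟨hi, (integral_mono hi hpay.1 fun x => (hl x).trans (hle x)).trans htot⟩
  exact ⟨key _ (g.fgm hv t i) (g.fg0 t i) fun x => by have := g.fG0 t i x; linarith,
    key _ (g.fGm t i) (g.fG0 t i) fun x => by have := g.fg0 t i x; linarith⟩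

end


section
variable {N d : ℕ} {μ : Fin N → Fin d → Measure ℝ} {v : Fin N → Fin d → ℝ → ℝ}
    {c : (Fin N → Fin d → ℝ) → ℝ}

/-- the functionals used in the Komlos argument -/
def FF (v : Fin N → Fin d → ℝ → ℝ) (K : ℝ) (k : Fin 4 × Fin N × Fin d) (e : Elt N d) (x : Fin N → Fin d → ℝ) : ℝ :=
  match k.1 with
  | 0 => fg v K e k.2.1 k.2.2 x
  | 1 => fG e k.2.1 k.2.2 x
  | 2 => f2 e k.2.1 k.2.2 x
  | 3 => f3 e k.2.1 k.2.2 x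

lemma FF_mid (K : ℝ) (k : Fin 4 × Fin N × Fin d) (e e' : Elt N d) (x : Fin N → Fin d → ℝ) :
    FF v K k (e.mid e') x = (FF v K k e x + FF v K k e' x) / 2 := by
  obtain ⟨k, t, i⟩ := k
  fin_cases k
  · simp only [FF, fg, Elt.mid, Pi.add_apply, Pi.smul_apply, smul_eq_mul]; ring
  · simp only [FF, fG, Elt.mid, Pi.add_apply, Pi.smul_apply, smul_eq_mul]
    split_ifs
    · ring
    · simp
  · simp only [FF, f2, Elt.mid, Pi.add_apply, Pi.smul_apply, smul_eq_mul]; ring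
  · simp only [FF, f3, Elt.mid, Pi.add_apply, Pi.smul_apply, smul_eq_mul]
    split_ifs
    · ring
    · simp

lemma conv_seq (hN : 0 < N) (hd : 0 < d)
    (hprob : ∀ t i, IsProbabilityMeasure (μ t i))
    (hmom : ∀ t i, Integrable id (μ t i))
    (hirr : ∀ (t : ℕ) (ht : t + 1 < N) (i : Fin d),
      IrreduciblePair (μ ⟨t, Nat.lt_of_succ_lt ht⟩ i) (μ ⟨t + 1, ht⟩ i))
    (hc : UpperSemicontinuous c)
    (hv : ∀ t i, Continuous (v t i) ∧ Integrable (v t i) (μ t i))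
    (hcbound : ∀ x, |c x| ≤ ∑ t : Fin N, ∑ i : Fin d, v t i (x t i))
    {π : Measure (Fin N → Fin d → ℝ)} (hπ : π ∈ VMT N d μ)
    (hmax : ∀ π' ∈ VMT N d μ, ∫ x, c x ∂π' ≤ ∫ x, c x ∂π) :
    ∃ (a : ℕ → Fin d → ℝ) (K : ℝ) (e : ℕ → Elt N d),
      (∀ n, Good μ v c a K (∫ x, c x ∂π + (1/2 : ℝ)^n) (e n)) ∧
      ∀ t i, ∀ᵐ y ∂(μ t i), ∃ b, Tendsto (fun n => (e n).φ t i y) atTop (nhds b) := by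
  have hpr := hπ.1
  set p := ∫ x, c x ∂π with hp
  have hIne : ∀ (t : ℕ) (ht : t + 1 < N) (i : Fin d), ∃ z,
      potentialFn (μ ⟨t, Nat.lt_of_succ_lt ht⟩ i) z < potentialFn (μ ⟨t + 1, ht⟩ i) z := by
    intro t ht i
    by_contra hcon
    have h1 := (hirr t ht i).2
    have : {x | potentialFn (μ ⟨t, Nat.lt_of_succ_lt ht⟩ i) x < potentialFn (μ ⟨t + 1, ht⟩ i) x} = ∅ := by
      ext x; simp only [Set.mem_setOf_eq, Set.mem_empty_iff_false, iff_false]; exact fun h => hcon ⟨x, h⟩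
    rw [this] at h1; simp at h1
  choose z hz using hIne
  set a : ℕ → Fin d → ℝ := fun s i => if hs : 0 < s ∧ s < N then z (s - 1) (by omega) i else 0 with ha
  have ha' : ∀ (t : ℕ) (ht : t + 1 < N) (i : Fin d), a (t+1) i = z t ht i := by
    intro t ht i
    simp only [ha]
    rw [dif_pos ⟨by omega, ht⟩]; rfl
  set K : ℝ := p + 1 + cost μ v with hK
  have hpow : ∀ n : ℕ, (1/2 : ℝ)^n ≤ 1 := fun n => pow_le_one₀ (by norm_num) (by norm_num)
  obtain ⟨e, he, hlim⟩ := komlos π (fun n => {e | Good μ v c a K (p + (1/2 : ℝ)^n) e})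
    (by
      intro m n hmn e he
      refine Good.mono he ?_
      have : (1/2 : ℝ)^n ≤ (1/2 : ℝ)^m := pow_le_pow_of_le_one (by norm_num) (by norm_num) hmn
      linarith)
    (by
      intro n
      obtain ⟨π', hπ', hdual⟩ := duality hN hd hprob hmom π hπ c hc v hv hcbound
      obtain ⟨φ, h, had, hh, hco⟩ := hdual ((1/2 : ℝ)^n) (by positivity)
      have hle := hmax π' hπ'
      have hpn := hpow n
      exact good_exists hN hd hprob hmom hπ hv hcbound had hh (C := p + (1/2 : ℝ)^n) (by linarith) (by linarith) a)
    Elt.mid (fun n e e' he he' => Good.mid he he')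
    (FF v K)
    (by
      rintro e he ⟨k, t, i⟩
      have g : Good μ v c a K _ e := he
      fin_cases k
      · exact g.fgm (fun t i => (hv t i).1.measurable) t i
      · exact g.fGm t i
      · exact g.f2m t i
      · exact g.f3m t i)
    (by
      rintro e he ⟨k, t, i⟩ x
      have g : Good μ v c a K _ e := he
      fin_cases k
      · exact g.fg0 t i x
      · exact g.fG0 t i x
      · exact g.χ0 _ _ _
      · exact g.f30 t i x)
    (fun e _ e' _ k x => FF_mid K k e e' x)
  have hg : ∀ n, Good μ v c a K (p + (1/2 : ℝ)^n) (e n) := he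
  have hg1 : ∀ n, Good μ v c a K (p + 1) (e n) := fun n => (hg n).mono (by have := hpow n; linarith)
  refine ⟨a, K, e, hg, ?_⟩
  have hvm : ∀ t i, Measurable (v t i) := fun t i => (hv t i).1.measurable
  have cg : ∀ t i, ∀ᵐ x ∂π, ∃ b, Tendsto (fun n => fg v K (e n) t i x) atTop (nhds b) := by
    intro t i
    have hb := fun n => ((hg1 n).int_bounds hprob hmom hπ hvm (fun t i => (hv t i).2) t i).1
    exact ae_tendsto_of_exp (fun n => fg v K (e n) t i) (fun n => (hb n).1) (fun n => (hg1 n).fgm hvm t i)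
      (fun n => (hg1 n).fg0 t i) _ (fun n => (hb n).2) (hlim (0, t, i))
  have cG : ∀ t i, ∀ᵐ x ∂π, ∃ b, Tendsto (fun n => fG (e n) t i x) atTop (nhds b) := by
    intro t i
    have hb := fun n => ((hg1 n).int_bounds hprob hmom hπ hvm (fun t i => (hv t i).2) t i).2
    exact ae_tendsto_of_exp (fun n => fG (e n) t i) (fun n => (hb n).1) (fun n => (hg1 n).fGm t i)
      (fun n => (hg1 n).fG0 t i) _ (fun n => (hb n).2) (hlim (1, t, i))
  -- boundedness on the interval
  have hGB : ∀ (t : ℕ) (ht : t + 1 < N) (i : Fin d), ∀ᵐ x ∂π,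
      GB (fun n => (e n).χ (t+1) i) (fun n => (e n).q (t+1) i) (x ⟨t, Nat.lt_of_succ_lt ht⟩ i) (x ⟨t+1, ht⟩ i) := by
    intro t ht i
    filter_upwards [cG ⟨t, Nat.lt_of_succ_lt ht⟩ i] with x hx
    obtain ⟨b, hb⟩ := hx
    obtain ⟨C, hC⟩ := hb.bddAbove_range
    refine ⟨C, fun n => ?_⟩
    have := hC ⟨n, rfl⟩
    simpa only [fG, dif_pos ht] using this
  have hbdd : ∀ (t : ℕ) (ht : t + 1 < N) (i : Fin d) (y : ℝ),
      potentialFn (μ ⟨t, Nat.lt_of_succ_lt ht⟩ i) y < potentialFn (μ ⟨t + 1, ht⟩ i) y →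
      ∃ C, ∀ n, |(e n).q (t+1) i y| ≤ C ∧ 0 ≤ (e n).χ (t+1) i y ∧ (e n).χ (t+1) i y ≤ C := by
    intro t ht i y hy
    refine bdd_on_interval (χ := fun n => (e n).χ (t+1) i) (q := fun n => (e n).q (t+1) i)
      (fun n => (hg n).sub (t+1) i) (hirr t ht i).1 (a := a (t+1) i) ?_ (fun n => (hg n).χa _ _)
      (fun n => (hg n).qa _ _) ?_ hy
    · rw [ha' t ht i]; exact hz t ht i
    · intro b hb
      rcases irr_pts hmom hπ t ht i _ (hGB t ht i) b hb with ⟨x, hx, hx2⟩ | ⟨⟨x, hx, h1, h2⟩, ⟨x', hx', h1', h2'⟩⟩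
      · exact Or.inl ⟨_, _, hx, hx2⟩
      · rw [h1] at hx; rw [h1'] at hx'
        exact Or.inr ⟨⟨_, h2, hx⟩, ⟨_, h2', hx'⟩⟩
  have hI : ∀ (t : ℕ) (ht : t + 1 < N) (i : Fin d), ∀ᵐ x ∂π,
      potentialFn (μ ⟨t, Nat.lt_of_succ_lt ht⟩ i) (x ⟨t, Nat.lt_of_succ_lt ht⟩ i) < potentialFn (μ ⟨t + 1, ht⟩ i) (x ⟨t, Nat.lt_of_succ_lt ht⟩ i) := by
    intro t ht i
    have h1 : ∀ᵐ y ∂(μ ⟨t, Nat.lt_of_succ_lt ht⟩ i), potentialFn (μ ⟨t, Nat.lt_of_succ_lt ht⟩ i) y < potentialFn (μ ⟨t + 1, ht⟩ i) y := by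
      refine (prob_compl_eq_zero_iff ?_).2 (hirr t ht i).2
      exact measurableSet_lt (pot_meas _) (pot_meas _)
    rw [← hπ.2.1 ⟨t, Nat.lt_of_succ_lt ht⟩ i] at h1
    have := ae_of_ae_map (meas_ev _ i).aemeasurable h1
    rw [hπ.2.1 ⟨t, Nat.lt_of_succ_lt ht⟩ i] at this
    exact this
  -- convergence of the convex functions
  have c2 : ∀ (t : ℕ) (ht : t + 1 < N) (i : Fin d), ∀ᵐ x ∂π,
      (∃ b, Tendsto (fun n => (e n).χ (t+1) i (x ⟨t, Nat.lt_of_succ_lt ht⟩ i)) atTop (nhds b)) ∧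
      (∃ b, Tendsto (fun n => (e n).χ (t+1) i (x ⟨t+1, ht⟩ i)) atTop (nhds b)) := by
    intro t ht i
    filter_upwards [hGB t ht i, hI t ht i, hlim (2, ⟨t, Nat.lt_of_succ_lt ht⟩, i), hlim (3, ⟨t, Nat.lt_of_succ_lt ht⟩, i)] with x hx1 hx2 hx3 hx4
    obtain ⟨C, hC⟩ := hbdd t ht i _ hx2
    obtain ⟨C', hC'⟩ := hx1
    obtain ⟨l, hl⟩ := hx3
    obtain ⟨l', hl'⟩ := hx4
    refine ⟨tendsto_of_exp_bdd' hl (C := C) fun n => (hC n).2.2, ?_⟩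
    simp only [FF, f3, dif_pos ht] at hl'
    refine tendsto_of_exp_bdd' hl' (C := C' + C + C * |x ⟨t+1, ht⟩ i - x ⟨t, Nat.lt_of_succ_lt ht⟩ i|) fun n => ?_
    have h1 := hC' n
    have h2 := (hC n).2.2
    have h3 : (e n).q (t+1) i (x ⟨t, Nat.lt_of_succ_lt ht⟩ i) * (x ⟨t+1, ht⟩ i - x ⟨t, Nat.lt_of_succ_lt ht⟩ i) ≤ C * |x ⟨t+1, ht⟩ i - x ⟨t, Nat.lt_of_succ_lt ht⟩ i| := by
      refine (le_abs_self _).trans ?_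
      rw [abs_mul]
      exact mul_le_mul_of_nonneg_right (hC n).1 (abs_nonneg _)
    linarith
  -- convergence of φ
  intro t i
  have hx : ∀ᵐ x ∂π, ∃ b, Tendsto (fun n => (e n).φ t i (x t i)) atTop (nhds b) := by
    have hA : ∀ᵐ x ∂π, ∃ b, Tendsto (fun n => (e n).χ t i (x t i)) atTop (nhds b) := by
      obtain ⟨t, ht⟩ := t
      cases t with
      | zero => 
        refine Eventually.of_forall fun x => ⟨0, ?_⟩
        simp only [(hg _).z0]
        exact tendsto_const_nhds
      | succ t =>
        filter_upwards [c2 t ht i] with x hx using hx.2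
    have hB : ∀ᵐ x ∂π, ∃ b, Tendsto (fun n => (e n).χ ((t : ℕ) + 1) i (x t i)) atTop (nhds b) := by
      by_cases ht : (t : ℕ) + 1 < N
      · filter_upwards [c2 t ht i] with x hx using hx.1
      · have : (t : ℕ) + 1 = N := by omega
        refine Eventually.of_forall fun x => ⟨0, ?_⟩
        simp only [this, (hg _).zN]
        exact tendsto_const_nhds
    filter_upwards [hA, hB, cg t i] with x ⟨b1, h1⟩ ⟨b2, h2⟩ ⟨b3, h3⟩
    refine ⟨b3 - v t i (x t i) - K + b1 - b2, ?_⟩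
    refine ((((h3.sub_const (v t i (x t i))).sub_const K).add h1).sub h2).congr fun n => ?_
    simp only [fg]; ring
  rw [← hπ.2.1 t i, ae_map_iff (meas_ev t i).aemeasurable]
  · exact hx
  · exact measurableSet_exists_tendsto fun n => (hg n).mφ t i

end


section
variable {N d : ℕ}

/-- one trading term -/
def Dt (h : (t : ℕ) → Fin d → (Fin t → Fin d → ℝ) → ℝ) (x : Fin N → Fin d → ℝ) (t : ℕ) (i : Fin d) : ℝ :=
  if ht : t + 1 < N then
    h (t + 1) i (fun s => x ⟨s.val, by have := s.isLt; omega⟩) * (x ⟨t + 1, ht⟩ i - x ⟨t, Nat.lt_of_succ_lt ht⟩ i)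
  else 0

/-- partial trading gains -/
def Tp (h : (t : ℕ) → Fin d → (Fin t → Fin d → ℝ) → ℝ) (x : Fin N → Fin d → ℝ) (m : ℕ) : ℝ :=
  ∑ t ∈ Finset.range m, ∑ i, Dt h x t i

lemma payR_eq_Tp (φ : Fin N → Fin d → ℝ → ℝ) (h : (t : ℕ) → Fin d → (Fin t → Fin d → ℝ) → ℝ) (x : Fin N → Fin d → ℝ) :
    payR N d φ h x = ∑ t, ∑ i, φ t i (x t i) + Tp h x N := by
  unfold payR Tp
  rw [← Fin.sum_univ_eq_sum_range (fun t => ∑ i, Dt h x t i) N, ← Finset.sum_add_distrib]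
  refine Finset.sum_congr rfl fun t _ => ?_
  rw [← Finset.sum_add_distrib]
  rfl

lemma Tp_update (h : (t : ℕ) → Fin d → (Fin t → Fin d → ℝ) → ℝ) (x : Fin N → Fin d → ℝ) (m : ℕ) (hm : m + 1 < N) (y : Fin d → ℝ) :
    Tp h (Function.update x ⟨m + 1, hm⟩ y) (m + 1) = Tp h x m +
      ∑ i, h (m + 1) i (fun s => x ⟨s.val, by have := s.isLt; omega⟩) * (y i - x ⟨m, by omega⟩ i) := by
  unfold Tp
  rw [Finset.sum_range_succ]
  have hne : ∀ s (hs : s < N), s ≤ m → Function.update x ⟨m + 1, hm⟩ y ⟨s, hs⟩ = x ⟨s, hs⟩ := by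
    intro s hs hsm
    rw [Function.update_of_ne]
    intro h; have := congrArg Fin.val h; simp at this; omega
  have hf : ∀ t (ht : t < N), t ≤ m → (fun s : Fin (t + 1) => Function.update x ⟨m + 1, hm⟩ y ⟨s.val, by have := s.isLt; omega⟩) =
      (fun s : Fin (t + 1) => x ⟨s.val, by have := s.isLt; omega⟩) := by
    intro t ht htm
    funext s
    exact hne _ _ (by have := s.isLt; omega)
  congr 1
  · refine Finset.sum_congr rfl fun t ht => Finset.sum_congr rfl fun i _ => ?_
    have htm := Finset.mem_range.1 ht
    unfold Dt
    split_ifs with h1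
    · rw [hf t (by omega) (by omega), hne t _ (by omega), hne (t+1) _ (by omega)]
    · rfl
  · refine Finset.sum_congr rfl fun i _ => ?_
    unfold Dt
    rw [dif_pos hm, hf m (by omega) le_rfl, hne m _ le_rfl, Function.update_self]

variable {φ : ℕ → Fin N → Fin d → ℝ → ℝ} {h : ℕ → (t : ℕ) → Fin d → (Fin t → Fin d → ℝ) → ℝ}
  {c : (Fin N → Fin d → ℝ) → ℝ} {S : Fin N → Fin d → Set ℝ}

lemma h_key (hS : ∀ (t : ℕ) (ht : t + 1 < N) i, ∀ y ∈ S ⟨t, Nat.lt_of_succ_lt ht⟩ i,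
      (∃ y' ∈ S ⟨t + 1, ht⟩ i, y < y') ∧ (∃ y' ∈ S ⟨t + 1, ht⟩ i, y' < y))
    (m : ℕ) (hm : m + 1 < N) (x : Fin N → Fin d → ℝ) (hx : ∀ t i, x t i ∈ S t i)
    (hA : ∀ x : Fin N → Fin d → ℝ, (∀ t i, x t i ∈ S t i) → ∃ C, ∀ n, -C ≤ Tp (h n) x (m + 1)) :
    ∃ C, ∃ δ > 0, ∀ n, δ * ∑ i, |h n (m + 1) i (fun s => x ⟨s.val, by have := s.isLt; omega⟩)| ≤ C + Tp (h n) x m := by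
  have hSx := fun i => hS m hm i (x ⟨m, by omega⟩ i) (hx _ i)
  choose u hu1 hu2 using fun i => (hSx i).1
  choose l hl1 hl2 using fun i => (hSx i).2
  set vt : (Fin d → Bool) → Fin d → ℝ := fun b i => if b i then u i else l i with hvt
  have hvS : ∀ b t i, Function.update x ⟨m + 1, hm⟩ (vt b) t i ∈ S t i := by
    intro b t i
    by_cases ht : t = ⟨m + 1, hm⟩
    · subst ht
      rw [Function.update_self]
      simp only [hvt]
      split_ifs
      · exact hu1 i
      · exact hl1 i
    · rw [Function.update_of_ne ht]; exact hx t i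
  choose C hC using fun b => hA _ (hvS b)
  obtain ⟨C0, hC0⟩ : ∃ C0, ∀ b, C b ≤ C0 := by
    obtain ⟨C0, hC0⟩ := (Set.finite_range C).bddAbove
    exact ⟨C0, fun b => hC0 ⟨b, rfl⟩⟩
  obtain ⟨δ, hδ, hδ'⟩ : ∃ δ > 0, ∀ i, δ ≤ u i - x ⟨m, by omega⟩ i ∧ δ ≤ x ⟨m, by omega⟩ i - l i := by
    have hpos : ∀ i, 0 < min (u i - x ⟨m, by omega⟩ i) (x ⟨m, by omega⟩ i - l i) := fun i =>
      lt_min (sub_pos.2 (hu2 i)) (sub_pos.2 (hl2 i))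
    rcases isEmpty_or_nonempty (Fin d) with he | he
    · exact ⟨1, one_pos, fun i => he.elim i⟩
    · obtain ⟨i0, hi0⟩ := Finite.exists_min (fun i => min (u i - x ⟨m, by omega⟩ i) (x ⟨m, by omega⟩ i - l i))
      refine ⟨_, hpos i0, fun i => ⟨(hi0 i).trans (min_le_left _ _), (hi0 i).trans (min_le_right _ _)⟩⟩
  refine ⟨C0, δ, hδ, fun n => ?_⟩
  set H : Fin d → ℝ := fun i => h n (m + 1) i (fun s => x ⟨s.val, by have := s.isLt; omega⟩) with hH
  have h1 := hC (fun i => decide (H i < 0)) n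
  rw [Tp_update] at h1
  have h2 := hC0 (fun i => decide (H i < 0))
  have h3 : ∑ i, H i * (vt (fun i => decide (H i < 0)) i - x ⟨m, by omega⟩ i) ≤ - (δ * ∑ i, |H i|) := by
    rw [Finset.mul_sum, ← Finset.sum_neg_distrib]
    refine Finset.sum_le_sum fun i _ => ?_
    simp only [hvt]
    by_cases hi : H i < 0
    · simp only [hi, decide_true, if_true]
      rw [abs_of_neg hi]
      nlinarith [(hδ' i).1]
    · simp only [hi, decide_false]
      rw [abs_of_nonneg (not_lt.1 hi)]
      have := (hδ' i).2
      have h0 := not_lt.1 hi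
      simp only [Bool.false_eq_true, if_false]
      nlinarith
  change δ * ∑ i, |H i| ≤ _
  linarith

lemma h_bdd (hS : ∀ (t : ℕ) (ht : t + 1 < N) i, ∀ y ∈ S ⟨t, Nat.lt_of_succ_lt ht⟩ i,
      (∃ y' ∈ S ⟨t + 1, ht⟩ i, y < y') ∧ (∃ y' ∈ S ⟨t + 1, ht⟩ i, y' < y))
    (hφ : ∀ t i, ∀ y ∈ S t i, ∃ C, ∀ n, φ n t i y ≤ C)
    (hp : ∀ n x, c x ≤ payR N d (φ n) (h n) x)
    (x : Fin N → Fin d → ℝ) (hx : ∀ t i, x t i ∈ S t i) (m : ℕ) (hm : m + 1 < N) (i : Fin d) :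
    ∃ C, ∀ n, |h n (m + 1) i (fun s => x ⟨s.val, by have := s.isLt; omega⟩)| ≤ C := by
  have hbase : ∀ x : Fin N → Fin d → ℝ, (∀ t i, x t i ∈ S t i) → ∃ C, ∀ n, -C ≤ Tp (h n) x N := by
    intro x hx
    choose C hC using fun t i => hφ t i (x t i) (hx t i)
    refine ⟨∑ t, ∑ i, C t i - c x, fun n => ?_⟩
    have h1 := hp n x
    rw [payR_eq_Tp] at h1
    have h2 : ∑ t, ∑ i, φ n t i (x t i) ≤ ∑ t, ∑ i, C t i :=
      Finset.sum_le_sum fun t _ => Finset.sum_le_sum fun i _ => hC t i n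
    linarith
  have hA : ∀ k m, m + k = N → ∀ x : Fin N → Fin d → ℝ, (∀ t i, x t i ∈ S t i) → ∃ C, ∀ n, -C ≤ Tp (h n) x m := by
    intro k
    induction k with
    | zero => intro m hm; rw [add_zero] at hm; subst hm; exact hbase
    | succ k ih =>
      intro m hm x hx
      have ih' := ih (m + 1) (by omega)
      by_cases hmN : m + 1 < N
      · obtain ⟨C, δ, hδ, hC⟩ := h_key hS m hmN x hx ih'
        refine ⟨C, fun n => ?_⟩
        have h1 := hC n
        have h2 : 0 ≤ δ * ∑ i, |h n (m + 1) i (fun s => x ⟨s.val, by have := s.isLt; omega⟩)| :=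
          mul_nonneg hδ.le (Finset.sum_nonneg fun i _ => abs_nonneg _)
        linarith
      · obtain ⟨C, hC⟩ := ih' x hx
        refine ⟨C, fun n => ?_⟩
        have h1 := hC n
        unfold Tp at h1 ⊢
        rw [Finset.sum_range_succ] at h1
        have : ∑ i, Dt (h n) x m i = 0 := Finset.sum_eq_zero fun i _ => by unfold Dt; rw [dif_neg hmN]
        linarith
  have hstep : ∀ m (hm : m + 1 < N), (∃ C, ∀ n, Tp (h n) x m ≤ C) → ∀ i,
      ∃ C, ∀ n, |h n (m + 1) i (fun s => x ⟨s.val, by have := s.isLt; omega⟩)| ≤ C := by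
    rintro m hm ⟨C', hC'⟩ i
    obtain ⟨C, δ, hδ, hC⟩ := h_key hS m hm x hx (hA (N - (m + 1)) (m + 1) (by omega))
    refine ⟨(C + C') / δ, fun n => ?_⟩
    rw [le_div_iff₀ hδ, mul_comm]
    have h1 := hC n
    have h2 := hC' n
    have h3 := Finset.single_le_sum (f := fun i => |h n (m + 1) i (fun s => x ⟨s.val, by have := s.isLt; omega⟩)|)
      (fun i _ => abs_nonneg _) (Finset.mem_univ i)
    have h4 := mul_le_mul_of_nonneg_left h3 hδ.le
    linarith
  have hup : ∀ m, m < N → ∃ C, ∀ n, Tp (h n) x m ≤ C := by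
    intro m
    induction m with
    | zero => intro _; exact ⟨0, fun n => by simp [Tp]⟩
    | succ m ih =>
      intro hm
      obtain ⟨C, hC⟩ := ih (by omega)
      choose B hB using hstep m hm ⟨C, hC⟩
      refine ⟨C + ∑ i, B i * |x ⟨m + 1, hm⟩ i - x ⟨m, by omega⟩ i|, fun n => ?_⟩
      have h1 := hC n
      unfold Tp at h1 ⊢
      rw [Finset.sum_range_succ]
      refine add_le_add h1 (Finset.sum_le_sum fun i _ => ?_)
      unfold Dt
      rw [dif_pos hm]
      refine (le_abs_self _).trans ?_
      rw [abs_mul]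
      exact mul_le_mul_of_nonneg_right (hB i n) (abs_nonneg _)
  exact hstep m hm (hup m (by omega)) i

end


section
variable {N d : ℕ}

lemma ereal_coe_sum {ι : Type*} (s : Finset ι) (f : ι → ℝ) : ((∑ j ∈ s, f j : ℝ) : EReal) = ∑ j ∈ s, (f j : EReal) := by
  classical
  induction s using Finset.induction_on with
  | empty => simp
  | insert j s hj ih => rw [Finset.sum_insert hj, Finset.sum_insert hj, EReal.coe_add, ih]

lemma ereal_sum_ne_bot {ι : Type*} (s : Finset ι) (f : ι → EReal) (hf : ∀ j ∈ s, f j ≠ ⊥) : ∑ j ∈ s, f j ≠ ⊥ := by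
  classical
  induction s using Finset.induction_on with
  | empty => simp
  | insert j s hj ih =>
    rw [Finset.sum_insert hj]
    have h1 := hf j (Finset.mem_insert_self _ _)
    have h2 := ih fun k hk => hf k (Finset.mem_insert_of_mem hk)
    rw [Ne, EReal.add_eq_bot_iff]
    tauto

lemma ereal_sum_top {ι : Type*} (s : Finset ι) (f : ι → EReal) (hf : ∀ j ∈ s, f j ≠ ⊥) (j : ι) (hj : j ∈ s) (hT : f j = ⊤) :
    ∑ k ∈ s, f k = ⊤ := by
  classical
  rw [← Finset.add_sum_erase s f hj, hT]
  exact EReal.top_add_of_ne_bot (ereal_sum_ne_bot _ _ fun k hk => hf k (Finset.mem_of_mem_erase hk))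

lemma payout_coe (φ : Fin N → Fin d → ℝ → EReal) (ψ : Fin N → Fin d → ℝ → ℝ)
    (h : (t : ℕ) → Fin d → (Fin t → Fin d → ℝ) → ℝ) (x : Fin N → Fin d → ℝ) (hx : ∀ t i, φ t i (x t i) = (ψ t i (x t i) : EReal)) :
    portfolioPayout N d φ h x = (payR N d ψ h x : EReal) := by
  unfold portfolioPayout payR
  rw [ereal_coe_sum]
  refine Finset.sum_congr rfl fun t _ => ?_
  rw [ereal_coe_sum]
  refine Finset.sum_congr rfl fun i _ => ?_
  rw [EReal.coe_add, hx]

lemma payout_top (φ : Fin N → Fin d → ℝ → EReal)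
    (h : (t : ℕ) → Fin d → (Fin t → Fin d → ℝ) → ℝ) (x : Fin N → Fin d → ℝ) (hb : ∀ t i y, φ t i y ≠ ⊥) (t i)
    (ht : φ t i (x t i) = ⊤) : portfolioPayout N d φ h x = ⊤ := by
  unfold portfolioPayout
  have h1 : ∀ t i (r : ℝ), φ t i (x t i) + (r : EReal) ≠ ⊥ := by
    intro t i r
    rw [Ne, EReal.add_eq_bot_iff]
    have := hb t i (x t i)
    have := EReal.coe_ne_bot r
    tauto
  refine ereal_sum_top _ _ (fun t _ => ereal_sum_ne_bot _ _ fun i _ => h1 _ _ _) t (Finset.mem_univ _) ?_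
  refine ereal_sum_top _ _ (fun i _ => h1 _ _ _) i (Finset.mem_univ _) ?_
  rw [ht]
  exact EReal.top_add_of_ne_bot (EReal.coe_ne_bot _)

lemma payR_tendsto (φ : ℕ → Fin N → Fin d → ℝ → ℝ) (h : ℕ → (t : ℕ) → Fin d → (Fin t → Fin d → ℝ) → ℝ)
    (ψ : Fin N → Fin d → ℝ → ℝ) (g : (t : ℕ) → Fin d → (Fin t → Fin d → ℝ) → ℝ) (x : Fin N → Fin d → ℝ)
    (h1 : ∀ t i, Tendsto (fun k => φ k t i (x t i)) atTop (nhds (ψ t i (x t i))))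
    (h2 : ∀ (t : ℕ) (ht : t + 1 < N) i, Tendsto (fun k => h k (t+1) i (fun s => x ⟨s.val, by have := s.isLt; omega⟩))
      atTop (nhds (g (t+1) i (fun s => x ⟨s.val, by have := s.isLt; omega⟩)))) :
    Tendsto (fun k => payR N d (φ k) (h k) x) atTop (nhds (payR N d ψ g x)) := by
  unfold payR
  refine tendsto_finsetSum _ fun t _ => tendsto_finsetSum _ fun i _ => (h1 t i).add ?_
  by_cases ht : (t : ℕ) + 1 < N
  · simp only [dif_pos ht]
    exact (h2 t ht i).mul_const _
  · simp only [dif_neg ht]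
    exact tendsto_const_nhds

end

/-- Dual attainment for the maximization multi-period vectorial MOT problem:
existence of a superhedging dual optimizer replicating the payoff under every
maximizing market model. -/
theorem dual_attainment_max (N d : ℕ) (hN : 2 ≤ N) (hd : 1 ≤ d)
    (μ : Fin N → Fin d → Measure ℝ)
    (hprob : ∀ t i, IsProbabilityMeasure (μ t i))
    (hmom : ∀ t i, Integrable id (μ t i))
    (hord : ∀ (t : ℕ) (ht : t + 1 < N) (i : Fin d),
      ConvexOrder1 (μ ⟨t, by omega⟩ i) (μ ⟨t + 1, ht⟩ i) ∧
      IrreduciblePair (μ ⟨t, by omega⟩ i) (μ ⟨t + 1, ht⟩ i))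
    (c : (Fin N → Fin d → ℝ) → ℝ)
    (hc : UpperSemicontinuous c)
    (v : Fin N → Fin d → ℝ → ℝ)
    (hv : ∀ t i, Continuous (v t i) ∧ Integrable (v t i) (μ t i))
    (hcbound : ∀ x, |c x| ≤ ∑ t : Fin N, ∑ i : Fin d, v t i (x t i)) :
    ∃ (φ : Fin N → Fin d → ℝ → EReal)
      (h : (t : ℕ) → Fin d → (Fin t → Fin d → ℝ) → ℝ),
      (∀ t i, Measurable (φ t i)) ∧
      (∀ t i x, φ t i x ≠ ⊥) ∧
      (∀ t i, ∀ᵐ y ∂(μ t i), φ t i y ≠ ⊤) ∧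
      (∀ t i, Measurable (h t i)) ∧
      (∀ x, (c x : EReal) ≤ portfolioPayout N d φ h x) ∧
      (∀ π ∈ VMT N d μ, (∀ π' ∈ VMT N d μ, ∫ x, c x ∂π' ≤ ∫ x, c x ∂π) →
        ∀ᵐ x ∂π, portfolioPayout N d φ h x = (c x : EReal)) := by
  classical
  by_cases hex : ∃ π ∈ VMT N d μ, ∀ π' ∈ VMT N d μ, ∫ x, c x ∂π' ≤ ∫ x, c x ∂π
  swap
  · refine ⟨fun t i y => (v t i y : EReal), 0, fun t i => measurable_coe_real_ereal.comp (hv t i).1.measurable,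
      fun t i x => EReal.coe_ne_bot _, fun t i => Eventually.of_forall fun y => EReal.coe_ne_top _,
      fun t i => measurable_const, fun x => ?_, fun π hπ hm => absurd ⟨π, hπ, hm⟩ hex⟩
    rw [payout_coe (fun t i y => (v t i y : EReal)) v 0 x (fun t i => rfl), payR_zero_h]
    exact EReal.coe_le_coe_iff.2 ((le_abs_self _).trans (hcbound x))
  obtain ⟨π₀, hπ₀, hmax₀⟩ := hex
  obtain ⟨a, K, e, hg, hconv⟩ := conv_seq (by omega) (by omega) hprob hmom (fun t ht i => (hord t ht i).2) hc hv hcbound hπ₀ hmax₀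
  set p := ∫ x, c x ∂π₀ with hp
  set S : Fin N → Fin d → Set ℝ := fun t i => {y | ∃ b, Tendsto (fun n => (e n).φ t i y) atTop (nhds b)} ∩
    {y | ∀ ht : (t : ℕ) + 1 < N, potentialFn (μ t i) y < potentialFn (μ ⟨(t : ℕ) + 1, ht⟩ i) y} with hSdef
  have hSm : ∀ t i, MeasurableSet (S t i) := by
    intro t i
    refine (measurableSet_exists_tendsto fun n => (hg n).mφ t i).inter ?_
    by_cases ht : (t : ℕ) + 1 < N
    · have : {y | ∀ ht : (t : ℕ) + 1 < N, potentialFn (μ t i) y < potentialFn (μ ⟨(t : ℕ) + 1, ht⟩ i) y} =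
        {y | potentialFn (μ t i) y < potentialFn (μ ⟨(t : ℕ) + 1, ht⟩ i) y} := by
        ext y; exact ⟨fun h => h ht, fun h _ => h⟩
      rw [this]
      exact measurableSet_lt (pot_meas _) (pot_meas _)
    · have : {y | ∀ ht : (t : ℕ) + 1 < N, potentialFn (μ t i) y < potentialFn (μ ⟨(t : ℕ) + 1, ht⟩ i) y} = Set.univ := by
        ext y; exact ⟨fun _ => trivial, fun _ h => absurd h ht⟩
      rw [this]; exact MeasurableSet.univ
  have hSae : ∀ t i, ∀ᵐ y ∂(μ t i), y ∈ S t i := by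
    intro t i
    have h1 : ∀ᵐ y ∂(μ t i), ∀ ht : (t : ℕ) + 1 < N, potentialFn (μ t i) y < potentialFn (μ ⟨(t : ℕ) + 1, ht⟩ i) y := by
      by_cases ht : (t : ℕ) + 1 < N
      · have : ∀ᵐ y ∂(μ t i), potentialFn (μ t i) y < potentialFn (μ ⟨(t : ℕ) + 1, ht⟩ i) y :=
          (prob_compl_eq_zero_iff (measurableSet_lt (pot_meas _) (pot_meas _))).2 (hord t ht i).2.2
        filter_upwards [this] with y hy _ using hy
      · exact Eventually.of_forall fun y h => absurd h ht
    filter_upwards [hconv t i, h1] with y hy1 hy2 using ⟨hy1, hy2⟩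
  have hSside : ∀ (t : ℕ) (ht : t + 1 < N) i, ∀ y ∈ S ⟨t, by omega⟩ i,
      (∃ y' ∈ S ⟨t + 1, ht⟩ i, y < y') ∧ (∃ y' ∈ S ⟨t + 1, ht⟩ i, y' < y) := by
    intro t ht i y hy
    exact both_sides (hmom _ i) (hmom _ i) (mean_eq hmom hπ₀ t ht i) (hy.2 ht) (hSae ⟨t + 1, ht⟩ i)
  have hφb : ∀ t i, ∀ y ∈ S t i, ∃ C, ∀ n, (e n).φ t i y ≤ C := by
    intro t i y hy
    obtain ⟨b, hb⟩ := hy.1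
    obtain ⟨C, hC⟩ := hb.bddAbove_range
    exact ⟨C, fun n => hC ⟨n, rfl⟩⟩
  have hhb := fun x hx => h_bdd (φ := fun n => (e n).φ) (h := fun n => (e n).h) (c := c) hSside hφb (fun n => (hg n).hedge) x hx
  obtain ⟨h, τ, hhm, hτ, hlimh⟩ := sel_nested (fun n => (e n).h) (fun n => (hg n).mh)
  set ψ : Fin N → Fin d → ℝ → ℝ := fun t i y => limsup (fun n => (e n).φ t i y) atTop with hψ
  have hψm : ∀ t i, Measurable (ψ t i) := fun t i => Measurable.limsup fun n => (hg n).mφ t i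
  have hψl : ∀ t i, ∀ y ∈ S t i, Tendsto (fun n => (e n).φ t i y) atTop (nhds (ψ t i y)) := by
    intro t i y hy
    obtain ⟨b, hb⟩ := hy.1
    have : ψ t i y = b := hb.limsup_eq
    rw [this]; exact hb
  set φ : Fin N → Fin d → ℝ → EReal := fun t i y => if y ∈ S t i then (ψ t i y : EReal) else ⊤ with hφ
  have hφbot : ∀ t i y, φ t i y ≠ ⊥ := by
    intro t i y
    simp only [hφ]
    split_ifs
    · exact EReal.coe_ne_bot _
    · exact top_ne_bot
  -- convergence along a subsequence
  have hsub : ∀ x : Fin N → Fin d → ℝ, (∀ t i, x t i ∈ S t i) → ∃ σ : ℕ → ℕ, StrictMono σ ∧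
      Tendsto (fun k => payR N d (e (σ k)).φ (e (σ k)).h x) atTop (nhds (payR N d ψ h x)) := by
    intro x hx
    have hle : N - 1 ≤ N := by omega
    refine ⟨fun k => τ (N - 1) k (rs hle x), hτ _ _, ?_⟩
    have hst := hτ (N - 1) (rs hle x)
    refine payR_tendsto (fun k => (e (τ (N - 1) k (rs hle x))).φ) (fun k => (e (τ (N - 1) k (rs hle x))).h) ψ h x
      (fun t i => (hψl t i _ (hx t i)).comp hst.tendsto_atTop) fun t ht i => ?_
    refine hlimh (N - 1) (rs hle x) ?_ (t + 1) (by omega) (by omega) i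
    intro r hr hr1 i
    obtain ⟨m, rfl⟩ : ∃ m, r = m + 1 := ⟨r - 1, by omega⟩
    exact hhb x hx m (by omega) i
  have hcoe : ∀ x : Fin N → Fin d → ℝ, (∀ t i, x t i ∈ S t i) → portfolioPayout N d φ h x = (payR N d ψ h x : EReal) := by
    intro x hx
    exact payout_coe φ ψ h x fun t i => by simp only [hφ]; rw [if_pos (hx t i)]
  refine ⟨φ, h, fun t i => ?_, hφbot, fun t i => ?_, hhm, fun x => ?_, fun π hπ hmax => ?_⟩
  · exact Measurable.ite (hSm t i) (measurable_coe_real_ereal.comp (hψm t i)) measurable_const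
  · filter_upwards [hSae t i] with y hy
    simp only [hφ]
    rw [if_pos hy]; exact EReal.coe_ne_top _
  · by_cases hx : ∀ t i, x t i ∈ S t i
    · rw [hcoe x hx]
      obtain ⟨σ, _, hσ⟩ := hsub x hx
      exact EReal.coe_le_coe_iff.2 (ge_of_tendsto hσ (Eventually.of_forall fun k => (hg (σ k)).hedge x))
    · push Not at hx
      obtain ⟨t, i, hti⟩ := hx
      rw [payout_top φ h x hφbot t i (by simp only [hφ]; rw [if_neg hti])]
      exact le_top
  · have hpr := hπ.1
    have hpeq : ∫ x, c x ∂π = p := le_antisymm (hmax₀ π hπ) (hmax π₀ hπ₀)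
    have hci : Integrable c π := by
      refine Integrable.mono' (g := fun x => ∑ t : Fin N, ∑ i : Fin d, v t i (x t i)) ?_ hc.measurable.aestronglyMeasurable
        (Eventually.of_forall fun x => by rw [Real.norm_eq_abs]; exact hcbound x)
      exact integrable_finsetSum _ fun t _ => integrable_finsetSum _ fun i _ =>
        vmt_integrable hπ t i (v t i) (hv t i).1.measurable (hv t i).2
    have hpay : ∀ n, Integrable (payR N d (e n).φ (e n).h) π ∧ ∫ x, payR N d (e n).φ (e n).h x ∂π = cost μ (e n).φ := by
      intro n
      obtain ⟨M, hM⟩ := (hg n).bh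
      exact vmt_pay hmom hπ _ _ (hg n).mφ (hg n).iφ (hg n).mh M hM
    have hsum := ae_summable_of (P := π) (fun n x => payR N d (e n).φ (e n).h x - c x) (fun n => (hpay n).1.sub hci)
      (fun n => Eventually.of_forall fun x => sub_nonneg.2 ((hg n).hedge x)) (fun n => (1/2 : ℝ)^n)
      (summable_geometric_of_lt_one (by norm_num) (by norm_num)) (fun n => by
        rw [integral_sub (hpay n).1 hci, (hpay n).2, hpeq]
        have := (hg n).hcost
        linarith)
    have hxS : ∀ᵐ x ∂π, ∀ t i, x t i ∈ S t i := by
      refine ae_all_iff.2 fun t => ae_all_iff.2 fun i => ?_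
      have h1 := hSae t i
      rw [← hπ.2.1 t i] at h1
      exact ae_of_ae_map (meas_ev t i).aemeasurable h1
    filter_upwards [hsum, hxS] with x hx1 hx2
    rw [hcoe x hx2]
    obtain ⟨σ, hσm, hσ⟩ := hsub x hx2
    have h1 := (hx1.tendsto_atTop_zero.comp hσm.tendsto_atTop).add_const (c x)
    have h2 : Tendsto (fun k => payR N d (e (σ k)).φ (e (σ k)).h x) atTop (nhds (c x)) := by
      rw [zero_add] at h1
      refine h1.congr fun k => ?_
      simp only [Function.comp]; ring
    rw [tendsto_nhds_unique hσ h2]
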